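/- arXiv:1402.2221 — 5 statements merged into one kernel-verified Lean document; each statement's English description precedes it below -/
import Mathlib

section
/- Suppose the non-diagonal entries π_{ij} (i ≠ j) are pairwise different prime numbers such that (min{π_{ij} : i ≠ j})² > max{π_{ij} : i ≠ j}, and π_{ii} = 1 for all i. Then the dual cone K_d^+ has exactly Σ_{p=1}^{d−1} C(d−2, p−1)·C(d, p) extreme directions (counted up to positive scaling). -/
noncomputable section

/-- The solvency cone induced by the matrix `π`: the set of all nonnegative linear
combinations of the vectors `π i j • e^i - e^j`. -/
def solvencyCone (d : ℕ) (π : Fin d → Fin d → ℝ) : Set (Fin d → ℝ) :=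
  {x | ∃ z : Fin d → Fin d → ℝ, (∀ i j, 0 ≤ z i j) ∧
    x = ∑ i : Fin d, ∑ j : Fin d, z i j • (π i j • (Pi.single i 1 : Fin d → ℝ) - (Pi.single j 1 : Fin d → ℝ))}

/-- The (positive) dual cone of a set `K ⊆ ℝ^d`. -/
def dualCone (d : ℕ) (K : Set (Fin d → ℝ)) : Set (Fin d → ℝ) :=
  {y | ∀ x ∈ K, 0 ≤ ∑ l : Fin d, x l * y l}

/-- `(P, N)` is a bipartition of the vertex set `{1,…,d}`: both parts are nonempty,
disjoint, and their union is everything. -/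
def IsBipartition (d : ℕ) (P N : Finset (Fin d)) : Prop :=
  P.Nonempty ∧ N.Nonempty ∧ Disjoint P N ∧ P ∪ N = Finset.univ

/-- `T` is a spanning tree of the bipartite digraph with arc set `E`:
its arcs lie in `E` and the underlying undirected graph on all of `Fin d`
is connected and acyclic. -/
def IsSpanningTreeOf (d : ℕ) (E T : Set (Fin d × Fin d)) : Prop :=
  T ⊆ E ∧ (SimpleGraph.fromRel (fun u v => (u, v) ∈ T)).IsTree

/-- `T` is a spanning tree of the bipartite digraph `G(P,N)` with arc set `P × N`. -/
def IsSpanningTree (d : ℕ) (P N : Finset (Fin d)) (T : Set (Fin d × Fin d)) : Prop :=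
  IsSpanningTreeOf d {a | a.1 ∈ P ∧ a.2 ∈ N} T

/-- The vector `y` is generated by the tree with arc set `T`:
`π i j * y i = y j > 0` along all arcs of `T`. -/
def GeneratedByTree (d : ℕ) (π : Fin d → Fin d → ℝ) (T : Set (Fin d × Fin d))
    (y : Fin d → ℝ) : Prop :=
  ∀ a ∈ T, π a.1 a.2 * y a.1 = y a.2 ∧ 0 < y a.2

/-- The vector `y` is feasible with respect to the bipartition `(P, N)`:
`π i j * y i ≥ y j > 0` for all `(i,j) ∈ P × N`. -/
def Feasible (d : ℕ) (π : Fin d → Fin d → ℝ) (P N : Finset (Fin d))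
    (y : Fin d → ℝ) : Prop :=
  ∀ i ∈ P, ∀ j ∈ N, y j ≤ π i j * y i ∧ 0 < y j

/-- `y` is a feasible tree solution with respect to `(P, N)`. -/
def IsFeasibleTreeSolution (d : ℕ) (π : Fin d → Fin d → ℝ) (P N : Finset (Fin d))
    (y : Fin d → ℝ) : Prop :=
  ∃ T : Set (Fin d × Fin d), IsSpanningTree d P N T ∧ GeneratedByTree d π T y ∧
    Feasible d π P N y

/-- `y` is an extreme direction of the cone `K`: it is a nonzero element of `K`
which cannot be written as the sum of two directions of `K` that are not positive
multiples of `y`. -/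
def IsExtremeDir (d : ℕ) (K : Set (Fin d → ℝ)) (y : Fin d → ℝ) : Prop :=
  y ∈ K ∧ y ≠ 0 ∧ ∀ u v : Fin d → ℝ, u ∈ K → v ∈ K → u ≠ 0 → v ≠ 0 → y = u + v →
    (∃ α : ℝ, 0 < α ∧ u = α • y) ∨ (∃ α : ℝ, 0 < α ∧ v = α • y)

/-- The degree of node `i` in the arc set `T`: the number of arcs incident to `i`. -/
def treeDeg (d : ℕ) (T : Set (Fin d × Fin d)) (i : Fin d) : ℕ :=
  {a ∈ T | a.1 = i ∨ a.2 = i}.ncard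

open Finset in
/-- The edges of the graph underlying an asymmetric relation are counted by its out-degrees. -/
theorem sum_outDegree_eq_natCard_edgeSet {V : Type*} [Fintype V] (R : V → V → Prop)
    [DecidableRel R] (hR : ∀ a b, R a b → ¬ R b a) :
    ∑ a, #{b | R a b} = Nat.card (SimpleGraph.fromRel R).edgeSet := by
  classical
  rw [Nat.card_eq_fintype_card, ← SimpleGraph.edgeFinset_card, ← card_sigma]
  refine card_bij (fun p _ ↦ s(p.1, p.2)) ?_ ?_ ?_
  · rintro ⟨a, b⟩ h
    simp only [mem_sigma, mem_univ, mem_filter, true_and] at h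
    simp only [SimpleGraph.mem_edgeFinset, SimpleGraph.mem_edgeSet, SimpleGraph.fromRel_adj]
    exact ⟨by rintro rfl; exact hR _ _ h h, Or.inl h⟩
  · rintro ⟨a, b⟩ h ⟨a', b'⟩ h' heq
    simp only [mem_sigma, mem_univ, mem_filter, true_and] at h h'
    simp only [Sym2.eq_iff] at heq
    obtain ⟨rfl, rfl⟩ | ⟨rfl, rfl⟩ := heq
    · rfl
    · exact absurd h' (hR _ _ h)
  · intro e he
    induction e using Sym2.ind with
    | _ a b =>
      simp only [SimpleGraph.mem_edgeFinset, SimpleGraph.mem_edgeSet,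
        SimpleGraph.fromRel_adj] at he
      obtain ⟨-, h | h⟩ := he
      · exact ⟨⟨a, b⟩, by simpa using h, rfl⟩
      · exact ⟨⟨b, a⟩, by simpa using h, Sym2.eq_swap⟩

/-- A finite nonempty forest has fewer edges than vertices. -/
theorem SimpleGraph.IsAcyclic.natCard_edgeSet_lt {V : Type*} [Finite V] [Nonempty V]
    {G : SimpleGraph V} (hG : G.IsAcyclic) : Nat.card G.edgeSet + 1 ≤ Nat.card V := by
  classical
  have := Fintype.ofFinite V
  obtain ⟨F, hGF, -, hF⟩ := SimpleGraph.connected_top.exists_isTree_le_of_le_of_isAcyclic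
    (le_top (a := G)) hG
  have h1 := hF.card_edgeFinset
  have h2 := Finset.card_le_card (SimpleGraph.edgeFinset_mono hGF)
  rw [Nat.card_eq_fintype_card, Nat.card_eq_fintype_card, ← SimpleGraph.edgeFinset_card]
  omega

open Finset in
/-- In an oriented forest, a nonempty vertex set which no arc leaves has total out-degree less
than its size. -/
theorem sum_outDegree_lt_card {V : Type*} [Fintype V] (R : V → V → Prop)
    [DecidableRel R] (hR : ∀ a b, R a b → ¬ R b a) (hG : (SimpleGraph.fromRel R).IsAcyclic)
    (S : Finset V) (hS : S.Nonempty) (hclosed : ∀ a ∈ S, ∀ b, R a b → b ∈ S) :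
    ∑ a ∈ S, #{b | R a b} + 1 ≤ #S := by
  classical
  have : Nonempty S := hS.to_subtype
  have hsum : ∑ a ∈ S, #{b | R a b} = ∑ a : S, #{b : S | R a b} := by
    rw [← sum_coe_sort]
    refine sum_congr rfl fun a _ ↦ ?_
    symm
    refine card_bij (fun b _ ↦ b.1) ?_ ?_ ?_
    · intro b hb
      simpa using hb
    · intro b _ b' _ h
      exact Subtype.ext h
    · intro b hb
      have hb' : R a b := by simpa using hb
      exact ⟨⟨b, hclosed a a.2 b hb'⟩, by simpa using hb', rfl⟩
  have hle : SimpleGraph.fromRel (fun a b : S ↦ R a b) ≤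
      (SimpleGraph.fromRel R).induce (S : Set V) := by
    intro a b hab
    rw [SimpleGraph.fromRel_adj] at hab
    exact ⟨fun h ↦ hab.1 (Subtype.ext h), hab.2⟩
  have h := ((hG.induce (S : Set V)).anti hle).natCard_edgeSet_lt
  rw [hsum, sum_outDegree_eq_natCard_edgeSet _ fun a b : S ↦ hR a b]
  simpa using h

open Finset in
/-- An oriented tree has one arc less than vertices. -/
theorem sum_outDegree_of_isTree {V : Type*} [Fintype V] (R : V → V → Prop)
    [DecidableRel R] (hR : ∀ a b, R a b → ¬ R b a) (hG : (SimpleGraph.fromRel R).IsTree) :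
    ∑ a, #{b | R a b} + 1 = Fintype.card V := by
  classical
  rw [sum_outDegree_eq_natCard_edgeSet R hR, Nat.card_eq_fintype_card,
    ← SimpleGraph.edgeFinset_card, hG.card_edgeFinset]

open Finset in
/-- Let `i` be a source of an oriented tree and `e` a weight function of total weight one less
than the number of vertices. If every nonempty vertex set which no arc leaves has weight less
than its size, then the out-degree of `i` is at most its weight. -/
theorem outDegree_le_of_forall_sum_lt {V : Type*} [Fintype V] (R : V → V → Prop)
    [DecidableRel R] (hirr : ∀ a, ¬ R a a) (hG : (SimpleGraph.fromRel R).IsAcyclic)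
    (e : V → ℕ) (he : ∑ a, e a + 1 = Fintype.card V)
    (hclosed : ∀ S : Finset V, S.Nonempty → (∀ a ∈ S, ∀ b, R a b → b ∈ S) →
      ∑ a ∈ S, e a + 1 ≤ #S)
    (i : V) (hi : ∀ a, ¬ R a i) : #{b | R i b} ≤ e i := by
  classical
  set G := SimpleGraph.fromRel R
  set comp := (G.deleteIncidenceSet i).connectedComponentMk
  set J : Finset V := univ.erase i
  have hmap : ∀ k ∈ J, comp k ∈ J.image comp := fun k hk ↦ mem_image_of_mem _ hk
  have hsum : ∑ k ∈ J, e k + #(J.image comp) ≤ #J := by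
    rw [← sum_fiberwise_of_maps_to hmap, card_eq_sum_card_fiberwise hmap, card_eq_sum_ones,
      ← sum_add_distrib]
    refine sum_le_sum fun c hc ↦ hclosed _ ?_ ?_
    · obtain ⟨k, hk, rfl⟩ := mem_image.1 hc
      exact ⟨k, mem_filter.2 ⟨hk, rfl⟩⟩
    · intro a ha b hab
      obtain ⟨haJ, rfl⟩ := mem_filter.1 ha
      have hai : a ≠ i := ne_of_mem_erase haJ
      have hbi : b ≠ i := by
        rintro rfl
        exact hi a hab
      refine mem_filter.2 ⟨mem_erase.2 ⟨hbi, mem_univ _⟩, ?_⟩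
      refine SimpleGraph.ConnectedComponent.sound (SimpleGraph.Adj.reachable ?_)
      rw [SimpleGraph.deleteIncidenceSet_adj]
      refine ⟨(SimpleGraph.fromRel_adj _ _ _).2 ⟨?_, Or.inr hab⟩, hbi, hai⟩
      rintro rfl
      exact hirr _ hab
  have hcard : #{b | R i b} ≤ #(J.image comp) := by
    have hadj : ∀ b, R i b → G.Adj i b := fun b hb ↦
      (SimpleGraph.fromRel_adj _ _ _).2 ⟨by rintro rfl; exact hirr _ hb, Or.inl hb⟩
    refine card_le_card_of_injOn comp ?_ ?_
    · intro b hb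
      have hb' : R i b := by simpa using hb
      exact hmap b (mem_erase.2 ⟨(hadj b hb').ne', mem_univ _⟩)
    · intro b hb b' hb' heq
      have hb : R i b := by simpa using hb
      have hb' : R i b' := by simpa using hb'
      by_contra hne
      refine SimpleGraph.isAcyclic_iff_forall_adj_isBridge.1 hG (hadj b hb) ?_
      have hadj' : (G.deleteEdges {s(i, b)}).Adj i b' := by
        rw [SimpleGraph.deleteEdges_adj]
        refine ⟨hadj b' hb', ?_⟩
        simp only [Set.mem_singleton_iff, Sym2.eq_iff, not_or, true_and]
        exact ⟨fun h ↦ hne h.symm, fun h ↦ (hadj b hb).ne h.1⟩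
      have hle : G.deleteIncidenceSet i ≤ G.deleteEdges {s(i, b)} := by
        intro u v huv
        rw [SimpleGraph.deleteIncidenceSet_adj] at huv
        rw [SimpleGraph.deleteEdges_adj]
        refine ⟨huv.1, ?_⟩
        simp only [Set.mem_singleton_iff, Sym2.eq_iff, not_or]
        exact ⟨fun h ↦ huv.2.1 h.1, fun h ↦ huv.2.2 h.2⟩
      exact hadj'.reachable.trans
        ((SimpleGraph.ConnectedComponent.exact heq).symm.mono hle)
  have h1 : ∑ k ∈ J, e k + e i = ∑ a, e a := sum_erase_add _ _ (mem_univ i)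
  have h2 : #J + 1 = Fintype.card V := card_erase_add_one (mem_univ i)
  omega

/-- The number of weight functions on `d` vertices of total weight `d - 1`. -/
theorem card_piAntidiag_univ_pred (d : ℕ) (hd : 2 ≤ d) :
    (Finset.piAntidiag (Finset.univ : Finset (Fin d)) (d - 1)).card =
      ∑ p ∈ Finset.Icc 1 (d - 1), (d - 2).choose (p - 1) * d.choose p := by
  have h1 : (Finset.piAntidiag (Finset.univ : Finset (Fin d)) (d - 1)).card =
      (d + (d - 1) - 1).choose (d - 1) := by
    have h := Finset.card_finsuppAntidiag_nat_eq_choose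
      (s := (Finset.univ : Finset (Fin d))) (d - 1)
    simpa [Finset.finsuppAntidiag] using h
  obtain ⟨m, rfl⟩ := Nat.exists_eq_add_of_le' hd
  rw [h1, show m + 2 + (m + 2 - 1) - 1 = m + (m + 2) by omega, Nat.add_choose_eq,
    Finset.Nat.sum_antidiagonal_eq_sum_range_succ_mk]
  rw [show m + 2 - 1 = m + 1 by omega, show m + 2 - 2 = m by omega, Finset.sum_range_succ,
    Nat.choose_succ_self, zero_mul, add_zero, ← Finset.sum_range_reflect,
    ← Finset.Ico_add_one_right_eq_Icc, Finset.sum_Ico_eq_sum_range]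
  refine Finset.sum_congr rfl fun k hk ↦ ?_
  have hk' : k ≤ m := Nat.lt_succ_iff.1 (Finset.mem_range.1 hk)
  rw [show m + 1 - 1 - k = m - k by omega, show 1 + k - 1 = k by omega, Nat.choose_symm hk',
    show m + 1 - (m - k) = 1 + k by omega]

/-- The off-diagonal entries of `π` are pairwise different primes, the smallest of which exceeds
the square root of the largest, and the diagonal entries are `1`. -/
structure IsPrimeRateMatrix {d : ℕ} (π : Fin d → Fin d → ℝ) : Prop where
  diag : ∀ i, π i i = 1
  prime : ∀ i j, i ≠ j → ∃ p : ℕ, p.Prime ∧ π i j = p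
  injective : ∀ i j i' j', i ≠ j → i' ≠ j' → π i j = π i' j' → (i, j) = (i', j')
  lt_sq : ∀ i j i' j', i ≠ j → i' ≠ j' → π i' j' < (π i j) ^ 2

/-- The arc `(i, j)` is tight for `y` if the constraint `y j ≤ π i j * y i` is an equality. -/
def IsTight {d : ℕ} (π : Fin d → Fin d → ℝ) (y : Fin d → ℝ) (i j : Fin d) : Prop :=
  i ≠ j ∧ π i j * y i = y j

open Classical in
/-- The number of tight arcs leaving `i`. -/
def tightOutDegree {d : ℕ} (π : Fin d → Fin d → ℝ) (y : Fin d → ℝ) (i : Fin d) : ℕ :=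
  (Finset.univ.filter fun j ↦ IsTight π y i j).card

/-- The undirected graph of tight arcs. -/
abbrev tightGraph {d : ℕ} (π : Fin d → Fin d → ℝ) (y : Fin d → ℝ) : SimpleGraph (Fin d) :=
  SimpleGraph.fromRel (IsTight π y)

theorem mem_dualCone_solvencyCone {d : ℕ} {π : Fin d → Fin d → ℝ} {y : Fin d → ℝ} :
    y ∈ dualCone d (solvencyCone d π) ↔ ∀ i j, y j ≤ π i j * y i := by
  have key : ∀ z : Fin d → Fin d → ℝ,
      ∑ l, (∑ i : Fin d, ∑ j : Fin d, z i j • (π i j • (Pi.single i 1 : Fin d → ℝ) -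
        (Pi.single j 1 : Fin d → ℝ))) l * y l = ∑ i, ∑ j, z i j * (π i j * y i - y j) := by
    intro z
    have hlin : ∀ x : Fin d → ℝ, ∑ l, x l * y l = (Fintype.linearCombination ℝ y) x := by
      intro x
      simp [Fintype.linearCombination_apply]
    rw [hlin, map_sum]
    refine Finset.sum_congr rfl fun i _ ↦ ?_
    rw [map_sum]
    refine Finset.sum_congr rfl fun j _ ↦ ?_
    simp [map_smul, map_sub]
  constructor
  · intro hy i j
    have h := hy _ ⟨fun a b ↦ if a = i ∧ b = j then 1 else 0, fun a b ↦ by positivity, rfl⟩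
    rw [key, Finset.sum_eq_single i, Finset.sum_eq_single j] at h
    · simpa using h
    · intro b _ hb
      simp [hb]
    · simp
    · intro a _ ha
      simp [ha]
    · simp
  · rintro hy x ⟨z, hz, rfl⟩
    rw [key]
    exact Finset.sum_nonneg fun i _ ↦ Finset.sum_nonneg fun j _ ↦
      mul_nonneg (hz i j) (sub_nonneg.2 (hy i j))

namespace IsPrimeRateMatrix

variable {d : ℕ} {π : Fin d → Fin d → ℝ} {y y' : Fin d → ℝ}

theorem one_lt (hπ : IsPrimeRateMatrix π) {i j : Fin d} (hij : i ≠ j) : 1 < π i j := by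
  obtain ⟨p, hp, h⟩ := hπ.prime i j hij
  rw [h]
  exact_mod_cast hp.one_lt

theorem one_le (hπ : IsPrimeRateMatrix π) (i j : Fin d) : 1 ≤ π i j := by
  obtain rfl | hij := eq_or_ne i j
  · exact (hπ.diag i).ge
  · exact (hπ.one_lt hij).le

theorem pos (hπ : IsPrimeRateMatrix π) (i j : Fin d) : 0 < π i j :=
  zero_lt_one.trans_le (hπ.one_le i j)

theorem lt_mul (hπ : IsPrimeRateMatrix π) {i j k : Fin d} (hik : i ≠ k) (hkj : k ≠ j) :
    π i j < π i k * π k j := by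
  have h1 := hπ.one_lt hik
  have h2 := hπ.one_lt hkj
  obtain rfl | hij := eq_or_ne i j
  · rw [hπ.diag]
    nlinarith
  · have h3 := hπ.lt_sq i k i j hik hij
    have h4 := hπ.lt_sq k j i j hkj hij
    obtain h | h := le_total (π i k) (π k j) <;> nlinarith

theorem nonneg (hπ : IsPrimeRateMatrix π) (hd : 2 ≤ d)
    (hy : y ∈ dualCone d (solvencyCone d π)) (i : Fin d) : 0 ≤ y i := by
  rw [mem_dualCone_solvencyCone] at hy
  have : Nontrivial (Fin d) := Fin.nontrivial_iff_two_le.2 hd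
  obtain ⟨j, hj⟩ := exists_ne i
  have h1 := hπ.one_lt hj
  have h2 := hπ.one_lt hj.symm
  have h3 := hy i j
  have h4 := hy j i
  by_contra! hneg
  have h5 : π j i * y j ≤ π j i * (π i j * y i) := mul_le_mul_of_nonneg_left h3 (hπ.pos j i).le
  nlinarith [mul_pos (sub_pos.2 h1) (sub_pos.2 h2)]

theorem apply_pos (hπ : IsPrimeRateMatrix π) (hd : 2 ≤ d)
    (hy : y ∈ dualCone d (solvencyCone d π)) (hy0 : y ≠ 0) (i : Fin d) : 0 < y i := by
  refine (hπ.nonneg hd hy i).lt_of_ne fun h ↦ hy0 (funext fun j ↦ ?_)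
  refine le_antisymm ?_ (hπ.nonneg hd hy j)
  simpa [← h] using mem_dualCone_solvencyCone.1 hy i j

theorem not_isTight_of_isTight (hπ : IsPrimeRateMatrix π)
    (hy : y ∈ dualCone d (solvencyCone d π)) (hpos : ∀ i, 0 < y i) {i j k : Fin d}
    (hik : IsTight π y i k) : ¬ IsTight π y k j := by
  intro hkj
  have h1 := mem_dualCone_solvencyCone.1 hy i j
  have h2 := hπ.lt_mul hik.1 hkj.1
  rw [← hkj.2, ← hik.2, ← mul_assoc] at h1
  nlinarith [le_of_mul_le_mul_right h1 (hpos i)]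

theorem isAcyclic_tightGraph (hπ : IsPrimeRateMatrix π) (hpos : ∀ i, 0 < y i) :
    (tightGraph π y).IsAcyclic := by
  rw [SimpleGraph.isAcyclic_iff_forall_adj_isBridge]
  suffices h : ∀ i j, IsTight π y i j → (tightGraph π y).IsBridge s(i, j) by
    intro i j hij
    obtain ⟨-, hij | hij⟩ := (SimpleGraph.fromRel_adj _ _ _).1 hij
    · exact h i j hij
    · rw [Sym2.eq_swap]
      exact h j i hij
  intro i j hij hreach
  obtain ⟨p, hp, hpij⟩ := hπ.prime i j hij.1
  suffices h : ∀ k, ((tightGraph π y).deleteEdges {s(i, j)}).Reachable i k →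
      ∃ m n : ℕ, ¬ p ∣ m ∧ ¬ p ∣ n ∧ y k * m = n * y i by
    obtain ⟨m, n, hm, hn, h⟩ := h j hreach
    rw [← hij.2, hpij] at h
    have h' : ((p * m : ℕ) : ℝ) = (n : ℕ) := by
      push_cast
      exact mul_right_cancel₀ (hpos i).ne' (by linarith)
    exact hn ⟨m, (Nat.cast_injective h').symm⟩
  intro k hk
  rw [SimpleGraph.reachable_iff_reflTransGen] at hk
  induction hk with
  | refl => exact ⟨1, 1, hp.one_lt.ne' ∘ Nat.dvd_one.1, hp.one_lt.ne' ∘ Nat.dvd_one.1, by simp⟩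
  | @tail a b _ hab ih =>
    obtain ⟨m, n, hm, hn, h⟩ := ih
    rw [SimpleGraph.deleteEdges_adj, SimpleGraph.fromRel_adj] at hab
    obtain ⟨⟨hne, hab | hab⟩, hmem⟩ := hab
    · obtain ⟨q, hq, hqab⟩ := hπ.prime a b hne
      have hpq : ¬ p ∣ q := by
        intro hdvd
        rw [Nat.prime_dvd_prime_iff_eq hp hq] at hdvd
        have := hπ.injective i j a b hij.1 hne (by rw [hpij, hqab, hdvd])
        simp_all
      refine ⟨m, q * n, hm, fun h ↦ (hp.dvd_mul.1 h).elim hpq hn, ?_⟩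
      push_cast
      rw [← hab.2, hqab, mul_assoc, h, mul_assoc]
    · obtain ⟨q, hq, hqab⟩ := hπ.prime b a hne.symm
      have hpq : ¬ p ∣ q := by
        intro hdvd
        rw [Nat.prime_dvd_prime_iff_eq hp hq] at hdvd
        have := hπ.injective i j b a hij.1 hne.symm (by rw [hpij, hqab, hdvd])
        simp_all
      refine ⟨q * m, n, fun h ↦ (hp.dvd_mul.1 h).elim hpq hm, hn, ?_⟩
      rw [← h, ← hab.2, hqab]
      push_cast
      ring

/-- Scaling up the coordinates in a set which no tight arc enters stays in the dual cone. -/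
theorem eventually_scale_mem (hπ : IsPrimeRateMatrix π)
    (hy : y ∈ dualCone d (solvencyCone d π)) (hpos : ∀ i, 0 < y i) (S : Set (Fin d))
    (hS : ∀ i j, IsTight π y i j → j ∈ S → i ∈ S) :
    ∀ᶠ ε in nhdsWithin (0 : ℝ) (Set.Ioi 0),
      (fun i ↦ y i * (1 + S.indicator (fun _ ↦ ε) i)) ∈ dualCone d (solvencyCone d π) := by
  simp only [mem_dualCone_solvencyCone] at hy ⊢
  rw [Filter.eventually_all]
  intro i
  rw [Filter.eventually_all]
  intro j
  have hεpos : ∀ᶠ ε in nhdsWithin (0 : ℝ) (Set.Ioi 0), 0 < ε := eventually_mem_nhdsWithin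
  by_cases hle : j ∈ S → i ∈ S
  · filter_upwards [hεpos] with ε hε
    have hind : S.indicator (fun _ ↦ ε) j ≤ S.indicator (fun _ ↦ ε) i := by
      by_cases hj : j ∈ S
      · simp [hj, hle hj]
      · simpa [hj] using Set.indicator_nonneg (fun _ _ ↦ hε.le) i
    have hnonneg : 0 ≤ S.indicator (fun _ ↦ ε) j := Set.indicator_nonneg (fun _ _ ↦ hε.le) j
    rw [← mul_assoc]
    exact mul_le_mul (hy i j) (by linarith) (by linarith) (mul_pos (hπ.pos i j) (hpos i)).le
  · push Not at hle
    have hij : i ≠ j := by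
      rintro rfl
      exact hle.2 hle.1
    have hlt : y j < π i j * y i :=
      (hy i j).lt_of_ne fun h ↦ hle.2 (hS i j ⟨hij, h.symm⟩ hle.1)
    have hcont : ContinuousAt (fun ε : ℝ ↦ y j * (1 + ε)) 0 := by fun_prop
    have hev := (hcont.eventually_lt_const (u := π i j * y i) (by simpa using hlt)).filter_mono
      (nhdsWithin_le_nhds (s := Set.Ioi 0))
    filter_upwards [hev] with ε hε
    simpa [hle.1, hle.2] using hε.le

theorem isExtremeDir_of_preconnected (hπ : IsPrimeRateMatrix π) (hd : 2 ≤ d)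
    (hy : y ∈ dualCone d (solvencyCone d π)) (hpos : ∀ i, 0 < y i)
    (hconn : (tightGraph π y).Preconnected) :
    IsExtremeDir d (dualCone d (solvencyCone d π)) y := by
  have r : Fin d := ⟨0, by omega⟩
  refine ⟨hy, fun h ↦ (hpos r).ne' (congrFun h r), fun u v hu hv hu0 _ huv ↦ Or.inl ?_⟩
  have hadj : ∀ i j, IsTight π y i j → u j * y i = u i * y j := by
    intro i j hij
    have h1 := mem_dualCone_solvencyCone.1 hu i j
    have h2 := mem_dualCone_solvencyCone.1 hv i j
    have h3 := hij.2
    have h4 : u j = π i j * u i := by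
      simp only [huv, Pi.add_apply] at h3
      linarith
    rw [h4, ← hij.2]
    ring
  have hall : ∀ k, u k * y r = u r * y k := by
    intro k
    have hk := hconn r k
    rw [SimpleGraph.reachable_iff_reflTransGen] at hk
    induction hk with
    | refl => rfl
    | @tail a b _ hab ih =>
      have h : u b * y a = u a * y b := by
        obtain ⟨-, hab | hab⟩ := (SimpleGraph.fromRel_adj _ _ _).1 hab
        · exact hadj a b hab
        · exact (hadj b a hab).symm
      refine mul_right_cancel₀ (hpos a).ne' ?_
      linear_combination y r * h + y b * ih
  refine ⟨u r / y r, div_pos (hπ.apply_pos hd hu hu0 r) (hpos r), funext fun k ↦ ?_⟩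
  rw [Pi.smul_apply, smul_eq_mul, div_mul_eq_mul_div, eq_div_iff (hpos r).ne', hall k]

theorem preconnected_of_isExtremeDir (hπ : IsPrimeRateMatrix π) (hd : 2 ≤ d)
    (hy : IsExtremeDir d (dualCone d (solvencyCone d π)) y) :
    (tightGraph π y).Preconnected := by
  obtain ⟨hmem, hy0, hext⟩ := hy
  have hpos := hπ.apply_pos hd hmem hy0
  intro a b
  by_contra hab
  set S : Set (Fin d) := {k | (tightGraph π y).Reachable a k}
  have hS : ∀ i j, IsTight π y i j → (i ∈ S ↔ j ∈ S) := by
    intro i j hij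
    have h : (tightGraph π y).Adj i j := (SimpleGraph.fromRel_adj _ _ _).2 ⟨hij.1, Or.inl hij⟩
    exact ⟨fun hi ↦ hi.trans h.reachable, fun hj ↦ hj.trans h.symm.reachable⟩
  have haS : a ∈ S := SimpleGraph.Reachable.refl a
  have hbS : b ∉ S := hab
  obtain ⟨ε, ⟨h1, h2⟩, hε⟩ :=
    (((hπ.eventually_scale_mem hmem hpos S fun i j hij ↦ (hS i j hij).2).and
      (hπ.eventually_scale_mem hmem hpos Sᶜ fun i j hij ↦ not_imp_not.2 (hS i j hij).1)).and
      eventually_mem_nhdsWithin).exists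
  replace hε : 0 < ε := hε
  have hscale : ∀ z ∈ dualCone d (solvencyCone d π),
      (2 + ε)⁻¹ • z ∈ dualCone d (solvencyCone d π) := by
    intro z hz
    rw [mem_dualCone_solvencyCone] at hz ⊢
    intro i j
    have h := mul_le_mul_of_nonneg_left (hz i j) (by positivity : 0 ≤ (2 + ε)⁻¹)
    simp only [Pi.smul_apply, smul_eq_mul]
    linarith
  have hne : ∀ c : Fin d → ℝ, (∀ i, 0 ≤ c i) → (2 + ε)⁻¹ • (fun i ↦ y i * (1 + c i)) ≠ 0 := by
    intro c hc h
    have h := congrFun h a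
    simp only [Pi.smul_apply, smul_eq_mul, Pi.zero_apply] at h
    have := hpos a
    have := hc a
    exact absurd h (by positivity)
  have hind : ∀ T : Set (Fin d), ∀ i, 0 ≤ T.indicator (fun _ ↦ ε) i := fun T i ↦
    Set.indicator_nonneg (fun _ _ ↦ hε.le) i
  have hmul : ∀ c : Fin d → ℝ, c a ≠ c b →
      ¬ ∃ α : ℝ, 0 < α ∧ (2 + ε)⁻¹ • (fun i ↦ y i * (1 + c i)) = α • y := by
    rintro c hc ⟨α, -, h⟩
    have hval : ∀ i, (2 + ε)⁻¹ * (1 + c i) = α := by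
      intro i
      have h := congrFun h i
      simp only [Pi.smul_apply, smul_eq_mul] at h
      exact mul_right_cancel₀ (hpos i).ne' (by linarith)
    have h3 := mul_left_cancel₀ (by positivity : (2 + ε)⁻¹ ≠ 0) ((hval a).trans (hval b).symm)
    exact hc (by linarith)
  obtain h | h := hext _ _ (hscale _ h1) (hscale _ h2) (hne _ (hind S)) (hne _ (hind Sᶜ)) (by
    funext i
    simp only [Pi.add_apply, Pi.smul_apply, smul_eq_mul]
    by_cases hi : i ∈ S
    · simp only [hi, Set.indicator_of_mem, Set.mem_compl_iff, not_true_eq_false,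
        not_false_eq_true, Set.indicator_of_notMem]
      field_simp
      ring
    · simp only [hi, Set.indicator_of_mem, Set.mem_compl_iff, not_false_eq_true,
        Set.indicator_of_notMem]
      field_simp
      ring)
  · exact hmul _ (by simp [haS, hbS, hε.ne']) h
  · exact hmul _ (by simp [haS, hbS, hε.ne]) h

theorem asymm_isTight (hπ : IsPrimeRateMatrix π)
    (hy : y ∈ dualCone d (solvencyCone d π)) (hpos : ∀ i, 0 < y i) (i j : Fin d)
    (hij : IsTight π y i j) : ¬ IsTight π y j i :=
  hπ.not_isTight_of_isTight hy hpos hij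

theorem sum_tightOutDegree_lt_card (hπ : IsPrimeRateMatrix π)
    (hy : y ∈ dualCone d (solvencyCone d π)) (hpos : ∀ i, 0 < y i)
    (S : Finset (Fin d)) (hS : S.Nonempty) (hclosed : ∀ i ∈ S, ∀ j, IsTight π y i j → j ∈ S) :
    ∑ i ∈ S, tightOutDegree π y i + 1 ≤ S.card := by
  classical
  exact sum_outDegree_lt_card _ (hπ.asymm_isTight hy hpos) (hπ.isAcyclic_tightGraph hpos) S hS
    hclosed

theorem sum_tightOutDegree (hπ : IsPrimeRateMatrix π) (hd : 2 ≤ d)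
    (hy : y ∈ dualCone d (solvencyCone d π)) (hpos : ∀ i, 0 < y i)
    (hconn : (tightGraph π y).Preconnected) :
    ∑ i, tightOutDegree π y i = d - 1 := by
  classical
  have : Nonempty (Fin d) := ⟨⟨0, by omega⟩⟩
  have h := sum_outDegree_of_isTree _ (hπ.asymm_isTight hy hpos)
    ⟨⟨hconn⟩, hπ.isAcyclic_tightGraph hpos⟩
  rw [Fintype.card_fin] at h
  exact Nat.eq_sub_of_add_eq h

/-- A ray is determined by the out-degrees of its tight arcs. -/
theorem exists_eq_smul_of_tightOutDegree_eq (hπ : IsPrimeRateMatrix π) (hd : 2 ≤ d)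
    (hy : y ∈ dualCone d (solvencyCone d π)) (hpos : ∀ i, 0 < y i)
    (hy' : y' ∈ dualCone d (solvencyCone d π)) (hpos' : ∀ i, 0 < y' i)
    (hsum : ∑ i, tightOutDegree π y i = d - 1)
    (heq : tightOutDegree π y = tightOutDegree π y') :
    ∃ α : ℝ, 0 < α ∧ y' = α • y := by
  classical
  have : Nonempty (Fin d) := ⟨⟨0, by omega⟩⟩
  obtain ⟨r, hr⟩ := Finite.exists_max fun k ↦ y' k / y k
  set m := y' r / y r
  have hle : ∀ i j, IsTight π y i j → y' j / y j ≤ y' i / y i := by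
    intro i j hij
    have h := mem_dualCone_solvencyCone.1 hy' i j
    rw [← hij.2, div_le_div_iff₀ (mul_pos (hπ.pos i j) (hpos i)) (hpos i)]
    nlinarith [hpos i]
  have hle' : ∀ i j, IsTight π y' i j → y' i / y i ≤ y' j / y j := by
    intro i j hij
    have h := mem_dualCone_solvencyCone.1 hy i j
    rw [← hij.2, div_le_div_iff₀ (hpos i) (hpos j)]
    nlinarith [hpos' i]
  set S : Finset (Fin d) := Finset.univ.filter fun k ↦ y' k / y k = m
  have hS : S.Nonempty := ⟨r, by simp [S, m]⟩
  have h1 : ∑ i ∈ S, tightOutDegree π y' i + 1 ≤ S.card := by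
    refine hπ.sum_tightOutDegree_lt_card hy' hpos' S hS fun i hi j hij ↦ ?_
    simp only [S, Finset.mem_filter, Finset.mem_univ, true_and] at hi ⊢
    exact (hr j).antisymm (hi ▸ hle' i j hij)
  obtain hc | hc := Sᶜ.eq_empty_or_nonempty
  · refine ⟨m, div_pos (hpos' r) (hpos r), funext fun k ↦ ?_⟩
    have hk : k ∈ S := by
      by_contra hk
      exact Finset.notMem_empty k (hc ▸ Finset.mem_compl.2 hk)
    rw [Pi.smul_apply, smul_eq_mul, ← (Finset.mem_filter.1 hk).2, div_mul_cancel₀ _ (hpos k).ne']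
  · have h2 : ∑ i ∈ Sᶜ, tightOutDegree π y i + 1 ≤ Sᶜ.card := by
      refine hπ.sum_tightOutDegree_lt_card hy hpos Sᶜ hc fun i hi j hij ↦ ?_
      simp only [S, Finset.mem_compl, Finset.mem_filter, Finset.mem_univ, true_and] at hi ⊢
      intro hj
      exact hi ((hr i).antisymm (hj ▸ hle i j hij))
    have h3 := Finset.sum_add_sum_compl S (tightOutDegree π y)
    have h4 := Finset.card_add_card_compl S
    rw [Fintype.card_fin] at h4
    rw [← heq] at h1
    omega

/-- A weighted geometric mean of total weight zero attains its maximum over the dual cone. -/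
theorem exists_isMax_sum_mul_log (hπ : IsPrimeRateMatrix π) (hd : 2 ≤ d) (w : Fin d → ℝ)
    (hw : ∑ i, w i = 0) (r : Fin d) :
    ∃ y ∈ dualCone d (solvencyCone d π), y r = 1 ∧ ∀ z ∈ dualCone d (solvencyCone d π),
      z ≠ 0 → ∑ i, w i * Real.log (z i) ≤ ∑ i, w i * Real.log (y i) := by
  set K : Set (Fin d → ℝ) := {y | y r = 1 ∧ ∀ i j, y j ≤ π i j * y i}
  have hne : ∀ y ∈ K, y ≠ 0 := by
    rintro y hy rfl
    simpa using hy.1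
  have hmem : ∀ y ∈ K, y ∈ dualCone d (solvencyCone d π) := fun y hy ↦
    mem_dualCone_solvencyCone.2 hy.2
  have hclosed : IsClosed K := by
    simp only [K, Set.ofPred_and, Set.ofPred_forall]
    refine (isClosed_eq (by fun_prop) (by fun_prop)).inter ?_
    exact isClosed_iInter fun i ↦ isClosed_iInter fun j ↦
      isClosed_le (by fun_prop) (by fun_prop)
  have hcompact : IsCompact K := by
    refine (isCompact_univ_pi fun j ↦ isCompact_Icc (a := 0) (b := π r j)).of_isClosed_subset
      hclosed fun y hy j _ ↦ ⟨hπ.nonneg hd (hmem y hy) j, ?_⟩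
    simpa [hy.1] using hy.2 r j
  have hcont : ContinuousOn (fun y : Fin d → ℝ ↦ ∑ i, w i * Real.log (y i)) K := by
    refine continuousOn_finsetSum _ fun i _ ↦ continuousOn_const.mul ?_
    exact ContinuousOn.log (by fun_prop) fun y hy ↦
      (hπ.apply_pos hd (hmem y hy) (hne y hy) i).ne'
  obtain ⟨y, hyK, hmax⟩ := hcompact.exists_isMaxOn
    ⟨fun _ ↦ 1, rfl, fun i j ↦ by simpa using hπ.one_le i j⟩ hcont
  refine ⟨y, hmem y hyK, hyK.1, fun z hz hz0 ↦ ?_⟩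
  have hpos := hπ.apply_pos hd hz hz0
  have hzK : (fun i ↦ z i / z r) ∈ K := by
    refine ⟨div_self (hpos r).ne', fun i j ↦ ?_⟩
    rw [← mul_div_assoc]
    exact div_le_div_of_nonneg_right (mem_dualCone_solvencyCone.1 hz i j) (hpos r).le
  have h := hmax hzK
  simp only [Set.mem_ofPred_eq] at h
  refine le_trans (le_of_eq ?_) h
  simp only [Real.log_div (hpos _).ne' (hpos r).ne', mul_sub, Finset.sum_sub_distrib,
    ← Finset.sum_mul, hw, zero_mul, sub_zero]

/-- Every out-degree sequence of total `d - 1` is realized by an extreme direction. -/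
theorem exists_isExtremeDir_tightOutDegree_eq (hπ : IsPrimeRateMatrix π) (hd : 2 ≤ d)
    (e : Fin d → ℕ) (he : ∑ i, e i = d - 1) (r : Fin d) :
    ∃ y, IsExtremeDir d (dualCone d (solvencyCone d π)) y ∧ y r = 1 ∧
      tightOutDegree π y = e := by
  classical
  have hdR : ((d - 1 : ℕ) : ℝ) = d - 1 := by
    rw [Nat.cast_sub (by omega), Nat.cast_one]
  obtain ⟨y, hy, hyr, hmax⟩ := hπ.exists_isMax_sum_mul_log hd (fun i ↦ (d - 1 : ℝ) - d * e i)
    (by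
      rw [Finset.sum_sub_distrib, ← Finset.mul_sum, ← Nat.cast_sum, he, hdR]
      simp only [Finset.sum_const, Finset.card_univ, Fintype.card_fin, nsmul_eq_mul, sub_self]) r
  have hy0 : y ≠ 0 := by
    rintro rfl
    simp at hyr
  have hpos := hπ.apply_pos hd hy hy0
  have hin : ∀ S : Finset (Fin d), (∀ i j, IsTight π y i j → j ∈ S → i ∈ S) →
      (d - 1) * S.card ≤ d * ∑ i ∈ S, e i := by
    intro S hS
    obtain ⟨ε, hε, hε0⟩ := ((hπ.eventually_scale_mem hy hpos S hS).and
      eventually_mem_nhdsWithin).exists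
    replace hε0 : 0 < ε := hε0
    have hlog : 0 < Real.log (1 + ε) := Real.log_pos (by linarith)
    have hterm : ∀ i, Real.log (y i * (1 + (S : Set (Fin d)).indicator (fun _ ↦ ε) i)) =
        Real.log (y i) + if i ∈ S then Real.log (1 + ε) else 0 := by
      intro i
      by_cases hi : i ∈ S
      · simp [hi, Real.log_mul (hpos i).ne' (by positivity : 1 + ε ≠ 0)]
      · simp [hi]
    have h := hmax _ hε fun h ↦ by
      have h := congrFun h r
      have : 0 ≤ (S : Set (Fin d)).indicator (fun _ ↦ ε) r :=
        Set.indicator_nonneg (fun _ _ ↦ hε0.le) r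
      simp only [hyr, one_mul, Pi.zero_apply] at h
      linarith
    simp only [hterm] at h
    simp only [mul_add, Finset.sum_add_distrib, mul_ite, mul_zero,
      Finset.sum_ite_mem, Finset.univ_inter, ← Finset.sum_mul, Finset.sum_sub_distrib,
      Finset.sum_const, nsmul_eq_mul, ← Finset.mul_sum] at h
    have h' : (S.card : ℝ) * (d - 1) - d * ∑ i ∈ S, (e i : ℝ) ≤ 0 :=
      nonpos_of_mul_nonpos_left (by linarith) hlog
    have h'' : (((d - 1) * S.card : ℕ) : ℝ) ≤ (d * ∑ i ∈ S, e i : ℕ) := by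
      push_cast
      rw [hdR]
      linarith
    exact_mod_cast h''
  have hout : ∀ S : Finset (Fin d), (∀ i ∈ S, ∀ j, IsTight π y i j → j ∈ S) →
      d * ∑ i ∈ S, e i ≤ (d - 1) * S.card := by
    intro S hS
    have h := hin Sᶜ fun i j hij hj ↦ by
      rw [Finset.mem_compl] at hj ⊢
      exact fun hi ↦ hj (hS i hi j hij)
    have h1 := Finset.sum_add_sum_compl S e
    have h2 := Finset.card_add_card_compl S
    rw [Fintype.card_fin] at h2
    have h3 : d * ∑ i ∈ S, e i + d * ∑ i ∈ Sᶜ, e i = (d - 1) * d := by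
      rw [← mul_add, h1, he, mul_comm]
    have h4 : (d - 1) * S.card + (d - 1) * Sᶜ.card = (d - 1) * d := by
      rw [← mul_add, h2]
    omega
  have hout_lt : ∀ S : Finset (Fin d), S.Nonempty →
      (∀ i ∈ S, ∀ j, IsTight π y i j → j ∈ S) → ∑ i ∈ S, e i + 1 ≤ S.card := by
    intro S hne hS
    refine Nat.lt_of_mul_lt_mul_left ((hout S hS).trans_lt ?_ : d * _ < d * _)
    exact Nat.mul_lt_mul_of_pos_right (by omega) hne.card_pos
  have hconn : (tightGraph π y).Preconnected := by
    intro a b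
    by_contra hab
    set S : Finset (Fin d) := Finset.univ.filter fun k ↦ (tightGraph π y).Reachable a k
    have hS : ∀ i j, IsTight π y i j → (i ∈ S ↔ j ∈ S) := by
      intro i j hij
      have h : (tightGraph π y).Adj i j := (SimpleGraph.fromRel_adj _ _ _).2 ⟨hij.1, Or.inl hij⟩
      simp only [S, Finset.mem_filter, Finset.mem_univ, true_and]
      exact ⟨fun hi ↦ hi.trans h.reachable, fun hj ↦ hj.trans h.symm.reachable⟩
    have haS : a ∈ S := by simp [S]
    have hbS : b ∉ S := by simpa [S] using hab
    have heq := (hin S fun i j hij ↦ (hS i j hij).2).antisymm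
      (hout S fun i hi j hij ↦ (hS i j hij).1 hi)
    have hdvd : d ∣ S.card := by
      have hcop : Nat.Coprime d (d - 1) :=
        ((Nat.coprime_self_sub_right (by omega)).2 (Nat.coprime_one_right d))
      exact hcop.dvd_of_dvd_mul_left ⟨_, heq⟩
    have hlt : S.card < d := by
      simpa using Finset.card_lt_univ_of_notMem hbS
    exact absurd (Nat.le_of_dvd (Finset.card_pos.2 ⟨a, haS⟩) hdvd) (by omega)
  have hle : ∀ i, tightOutDegree π y i ≤ e i := by
    intro i
    by_cases hi : ∃ a, IsTight π y a i
    · obtain ⟨a, ha⟩ := hi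
      have : tightOutDegree π y i = 0 := by
        rw [tightOutDegree, Finset.card_eq_zero, Finset.filter_eq_empty_iff]
        exact fun j _ ↦ hπ.not_isTight_of_isTight hy hpos ha
      omega
    · push Not at hi
      refine outDegree_le_of_forall_sum_lt _ (fun a ha ↦ ha.1 rfl)
        (hπ.isAcyclic_tightGraph hpos) e ?_ hout_lt i hi
      rw [he, Fintype.card_fin]
      omega
  refine ⟨y, hπ.isExtremeDir_of_preconnected hd hy hpos hconn, hyr, funext fun i ↦ ?_⟩
  exact (Finset.sum_eq_sum_iff_of_le fun i _ ↦ hle i).1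
    ((hπ.sum_tightOutDegree hd hy hpos hconn).trans he.symm) i (Finset.mem_univ i)

end IsPrimeRateMatrix

/-- Example 11: if the off-diagonal entries of `π` are pairwise different prime
numbers whose minimum squared exceeds their maximum, and `π i i = 1`, then `K_d^+`
has exactly `∑_{p=1}^{d-1} C(d-2,p-1) · C(d,p)` extreme directions (up to positive
scaling). -/
theorem exact_extremeDirs_of_primes (d : ℕ) (hd : 2 ≤ d) (π : Fin d → Fin d → ℝ)
    (h1 : ∀ i, π i i = 1)
    (hprime : ∀ i j, i ≠ j → ∃ p : ℕ, p.Prime ∧ π i j = p)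
    (hdiff : ∀ i j i' j', i ≠ j → i' ≠ j' → π i j = π i' j' → (i, j) = (i', j'))
    (hminmax : ∀ i j i' j', i ≠ j → i' ≠ j' → π i' j' < (π i j) ^ 2) :
    ∃ Y : Finset (Fin d → ℝ),
      Y.card = ∑ p ∈ Finset.Icc 1 (d - 1), (d - 2).choose (p - 1) * d.choose p ∧
      (∀ z ∈ Y, IsExtremeDir d (dualCone d (solvencyCone d π)) z) ∧
      (∀ z ∈ Y, ∀ w ∈ Y, (∃ α : ℝ, 0 < α ∧ z = α • w) → z = w) ∧
      (∀ y : Fin d → ℝ, IsExtremeDir d (dualCone d (solvencyCone d π)) y →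
        ∃ z ∈ Y, ∃ α : ℝ, 0 < α ∧ y = α • z) := by
  have hπ : IsPrimeRateMatrix π := ⟨h1, hprime, hdiff, hminmax⟩
  classical
  set r : Fin d := ⟨0, by omega⟩
  have hex : ∀ e : Fin d → ℕ, ∃ y : Fin d → ℝ, e ∈ Finset.piAntidiag Finset.univ (d - 1) →
      IsExtremeDir d (dualCone d (solvencyCone d π)) y ∧ y r = 1 ∧ tightOutDegree π y = e := by
    intro e
    by_cases he : e ∈ Finset.piAntidiag Finset.univ (d - 1)
    · obtain ⟨y, hy⟩ :=
        hπ.exists_isExtremeDir_tightOutDegree_eq hd e (Finset.mem_piAntidiag.1 he).1 r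
      exact ⟨y, fun _ ↦ hy⟩
    · exact ⟨0, fun h ↦ absurd h he⟩
  choose ray hray using hex
  refine ⟨(Finset.piAntidiag Finset.univ (d - 1)).image ray, ?_, ?_, ?_, ?_⟩
  · rw [Finset.card_image_of_injOn, card_piAntidiag_univ_pred d hd]
    intro e he e' he' h
    rw [← (hray e he).2.2, ← (hray e' he').2.2, h]
  · intro z hz
    obtain ⟨e, he, rfl⟩ := Finset.mem_image.1 hz
    exact (hray e he).1
  · rintro z hz w hw ⟨α, -, h⟩
    obtain ⟨e, he, rfl⟩ := Finset.mem_image.1 hz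
    obtain ⟨e', he', rfl⟩ := Finset.mem_image.1 hw
    have hα := congrFun h r
    rw [Pi.smul_apply, (hray e he).2.1, (hray e' he').2.1, smul_eq_mul, mul_one] at hα
    rw [h, ← hα, one_smul]
  · intro y hy
    have hpos := hπ.apply_pos hd hy.1 hy.2.1
    have hsum := hπ.sum_tightOutDegree hd hy.1 hpos (hπ.preconnected_of_isExtremeDir hd hy)
    have he : tightOutDegree π y ∈ Finset.piAntidiag Finset.univ (d - 1) := by
      simpa [Finset.mem_piAntidiag] using hsum
    obtain ⟨hext, -, hdeg⟩ := hray _ he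
    refine ⟨_, Finset.mem_image_of_mem ray he, ?_⟩
    exact hπ.exists_eq_smul_of_tightOutDegree_eq hd hext.1 (hπ.apply_pos hd hext.1 hext.2.1)
      hy.1 hpos (by rw [hdeg, hsum]) hdeg
end
end

section
/- In the bid-ask special case π_{ij} = a_j/b_i (i ≠ j), π_{ii} = 1, the dual cone satisfies K_d^+ = cone{ y ∈ ℝ^d : (P,N) is a bipartition of V, y_i = b_i for all i ∈ P, y_j = a_j for all j ∈ N }, and the solvency cone satisfies K_d = { x ∈ ℝ^d : Σ_{i∈P} b_i x_i + Σ_{j∈N} a_j x_j ≥ 0 for all bipartitions (P,N) of V }. Moreover, K_d^+ has at most 2^d − 2 extreme directions (counted up to positive scaling). -/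
noncomputable section

/-- The bid-ask market price matrix: `π i i = 1` and `π i j = a j / b i` for `i ≠ j`. -/
def bidAsk (d : ℕ) (a b : Fin d → ℝ) : Fin d → Fin d → ℝ :=
  fun i j => if i = j then 1 else a j / b i

/-- The vector associated to a bipartition `(Q, Qᶜ)`: components `b i` on `Q`
and `a j` on the complement. -/
def bipVec (d : ℕ) (a b : Fin d → ℝ) (Q : Finset (Fin d)) : Fin d → ℝ :=
  fun i => if i ∈ Q then b i else a i

/-- The solvency cone as a pointed cone. -/
def solvencyPointedCone (d : ℕ) (π : Fin d → Fin d → ℝ) : PointedCone ℝ (Fin d → ℝ) where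
  carrier := solvencyCone d π
  zero_mem' := ⟨0, fun _ _ => le_rfl, by simp⟩
  add_mem' := by
    rintro _ _ ⟨z, hz, rfl⟩ ⟨w, hw, rfl⟩
    exact ⟨z + w, fun i j => add_nonneg (hz i j) (hw i j), by
      simp only [Pi.add_apply, add_smul, Finset.sum_add_distrib]⟩
  smul_mem' := by
    rintro ⟨c, hc⟩ _ ⟨z, hz, rfl⟩
    exact ⟨c • z, fun i j => mul_nonneg hc (hz i j), by
      simp only [Nonneg.mk_smul, Finset.smul_sum, Pi.smul_apply, smul_assoc]⟩

/-- The dual cone as a pointed cone. -/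
def dualPointedCone (d : ℕ) (K : Set (Fin d → ℝ)) : PointedCone ℝ (Fin d → ℝ) where
  carrier := dualCone d K
  zero_mem' := fun x _ => by simp
  add_mem' := by
    intro u v hu hv x hx
    simpa [mul_add, Finset.sum_add_distrib] using add_nonneg (hu x hx) (hv x hx)
  smul_mem' := by
    rintro ⟨c, hc⟩ u hu x hx
    simpa [mul_left_comm, Finset.mul_sum] using mul_nonneg hc (hu x hx)

/-- The cone generated by the vectors of all bipartitions. -/
def bipPointedCone (d : ℕ) (a b : Fin d → ℝ) : PointedCone ℝ (Fin d → ℝ) where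
  carrier := {y | ∃ z : Finset (Fin d) → ℝ, (∀ Q, 0 ≤ z Q) ∧
    (∀ Q, z Q ≠ 0 → Q.Nonempty ∧ Q ≠ Finset.univ) ∧
    y = ∑ Q : Finset (Fin d), z Q • bipVec d a b Q}
  zero_mem' := ⟨0, fun _ => le_rfl, fun _ h => (h rfl).elim, by simp⟩
  add_mem' := by
    rintro _ _ ⟨z, hz, hz', rfl⟩ ⟨w, hw, hw', rfl⟩
    refine ⟨z + w, fun Q => add_nonneg (hz Q) (hw Q), fun Q hQ => ?_, by
      simp only [Pi.add_apply, add_smul, Finset.sum_add_distrib]⟩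
    by_cases h : z Q = 0
    · exact hw' Q fun h' => hQ (by simp [h, h'])
    · exact hz' Q h
  smul_mem' := by
    rintro ⟨c, hc⟩ _ ⟨z, hz, hz', rfl⟩
    exact ⟨c • z, fun Q => mul_nonneg hc (hz Q), fun Q hQ => hz' Q fun h => hQ (by simp [h]), by
      simp only [Nonneg.mk_smul, Finset.smul_sum, Pi.smul_apply, smul_assoc]⟩

section

variable {d : ℕ} {a b : Fin d → ℝ}

theorem generator_mem_solvencyPointedCone (π : Fin d → Fin d → ℝ) (i j : Fin d) :
    π i j • (Pi.single i 1 : Fin d → ℝ) - Pi.single j 1 ∈ solvencyPointedCone d π := by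
  refine ⟨Pi.single i (Pi.single j 1), fun k l => ?_, ?_⟩
  · by_cases hk : k = i
    · subst hk
      by_cases hl : l = j
      · subst hl; simp
      · simp [hl]
    · simp [hk]
  · rw [Finset.sum_eq_single i, Finset.sum_eq_single j]
    · simp
    · intro l _ hl; simp [hl]
    · simp
    · intro k _ hk; simp [hk]
    · simp

theorem mem_dualCone_solvencyCone_iff (π : Fin d → Fin d → ℝ) (y : Fin d → ℝ) :
    y ∈ dualCone d (solvencyCone d π) ↔ ∀ i j, y j ≤ π i j * y i := by
  constructor
  · intro h i j
    have h' : 0 ≤ (π i j • (Pi.single i 1 : Fin d → ℝ) - Pi.single j 1) ⬝ᵥ y :=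
      h _ (generator_mem_solvencyPointedCone π i j)
    simpa [sub_dotProduct] using h'
  · rintro h _ ⟨z, hz, rfl⟩
    change 0 ≤ (∑ i : Fin d, ∑ j : Fin d, z i j •
      (π i j • (Pi.single i 1 : Fin d → ℝ) - (Pi.single j 1 : Fin d → ℝ))) ⬝ᵥ y
    simp only [sum_dotProduct, smul_dotProduct, sub_dotProduct, single_one_dotProduct, smul_eq_mul]
    exact Finset.sum_nonneg fun i _ => Finset.sum_nonneg fun j _ =>
      mul_nonneg (hz i j) (sub_nonneg.2 (h i j))

theorem mem_dualCone_bidAsk_iff (hb : ∀ i, 0 < b i) (y : Fin d → ℝ) :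
    y ∈ dualCone d (solvencyCone d (bidAsk d a b)) ↔
      ∀ i j, i ≠ j → b i * y j ≤ a j * y i := by
  rw [mem_dualCone_solvencyCone_iff]
  refine forall₂_congr fun i j => ?_
  by_cases h : i = j
  · simp [h, bidAsk]
  · simp only [bidAsk, h, if_false, ne_eq, not_false_eq_true, forall_const]
    rw [div_mul_eq_mul_div, le_div_iff₀ (hb i), mul_comm]

theorem le_bipVec (hba : ∀ i, b i ≤ a i) (Q : Finset (Fin d)) (i : Fin d) :
    b i ≤ bipVec d a b Q i := by
  unfold bipVec; split_ifs; exacts [le_rfl, hba i]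

theorem bipVec_le (hba : ∀ i, b i ≤ a i) (Q : Finset (Fin d)) (i : Fin d) :
    bipVec d a b Q i ≤ a i := by
  unfold bipVec; split_ifs; exacts [hba i, le_rfl]

theorem bipVec_mem_dualCone (hb : ∀ i, 0 < b i) (hba : ∀ i, b i ≤ a i) (Q : Finset (Fin d)) :
    bipVec d a b Q ∈ dualCone d (solvencyCone d (bidAsk d a b)) := by
  rw [mem_dualCone_bidAsk_iff hb]
  intro i j _
  have hj := (hb j).trans_le (hba j)
  nlinarith [mul_le_mul_of_nonneg_left (bipVec_le hba Q j) (hb i).le,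
    mul_le_mul_of_nonneg_left (le_bipVec hba Q i) hj.le]

theorem bipVec_mem_of_proper {Q : Finset (Fin d)} (hQ : Q.Nonempty) (hQ' : Q ≠ Finset.univ) :
    bipVec d a b Q ∈ bipPointedCone d a b := by
  classical
  refine ⟨Pi.single Q 1, fun R => ?_, fun R hR => ?_, ?_⟩
  · by_cases h : R = Q
    · subst h; simp
    · simp [h]
  · by_cases h : R = Q
    · exact h ▸ ⟨hQ, hQ'⟩
    · simp [h] at hR
  · rw [Finset.sum_eq_single Q]
    · simp
    · intro R _ hR; simp [hR]
    · simp

theorem ask_mem_bipPointedCone (hd : 2 ≤ d) (hb : ∀ i, 0 < b i) (hba : ∀ i, b i ≤ a i) :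
    a ∈ bipPointedCone d a b := by
  have hsingle : ∀ i, bipVec d a b {i} ∈ bipPointedCone d a b := fun i =>
    bipVec_mem_of_proper (Finset.singleton_nonempty i) fun h => by
      have := congrArg Finset.card h
      simp at this
      lia
  by_cases heq : ∃ i, b i = a i
  · obtain ⟨i, hi⟩ := heq
    convert hsingle i using 1
    ext j
    by_cases h : j = i
    · simp [bipVec, h, hi]
    · simp [bipVec, h]
  push Not at heq
  have hlt : ∀ i, 0 < a i - b i := fun i => sub_pos.2 (lt_of_le_of_ne (hba i) (heq i))
  set c : Fin d → ℝ := fun i => a i / (a i - b i) with hc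
  have hc1 : ∀ i, 1 < c i := fun i => by
    rw [hc]; simp only; rw [one_lt_div (hlt i)]; linarith [hb i]
  have hsum : 1 < ∑ i, c i := by
    let i₀ : Fin d := ⟨0, by lia⟩
    exact (hc1 i₀).trans_le (Finset.single_le_sum (f := c)
      (fun i _ => (zero_lt_one.trans (hc1 i)).le) (Finset.mem_univ i₀))
  have hmem : ∑ i, c i • bipVec d a b {i} ∈ bipPointedCone d a b :=
    sum_mem fun i _ => PointedCone.smul_mem _ (zero_lt_one.trans (hc1 i)).le (hsingle i)
  have hval : ∑ i, c i • bipVec d a b {i} = (∑ i, c i - 1) • a := by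
    ext j
    have h : ∀ i, c i * bipVec d a b {i} j = c i * a j - if j = i then a j else 0 := by
      intro i
      by_cases h : j = i
      · subst h
        have := (hlt j).ne'
        simp only [bipVec, Finset.mem_singleton, if_true, hc]
        field_simp
        ring
      · simp [bipVec, h]
    simp only [Finset.sum_apply, Pi.smul_apply, smul_eq_mul, h, Finset.sum_sub_distrib,
      ← Finset.sum_mul]
    simp [sub_mul]
  have := PointedCone.smul_mem _ (inv_nonneg.2 (sub_pos.2 hsum).le) (hval ▸ hmem)
  rwa [smul_smul, inv_mul_cancel₀ (sub_pos.2 hsum).ne', one_smul] at this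

theorem bid_mem_bipPointedCone (hd : 2 ≤ d) (hb : ∀ i, 0 < b i) (hba : ∀ i, b i ≤ a i) :
    b ∈ bipPointedCone d a b := by
  have hcompl : ∀ i, bipVec d a b {i}ᶜ ∈ bipPointedCone d a b := fun i =>
    bipVec_mem_of_proper (by
      rw [← Finset.card_pos, Finset.card_compl, Finset.card_singleton, Fintype.card_fin]
      lia) (by simp)
  by_cases heq : ∃ i, b i = a i
  · obtain ⟨i, hi⟩ := heq
    convert hcompl i using 1
    ext j
    by_cases h : j = i
    · simp [bipVec, h, hi]
    · simp [bipVec, h]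
  push Not at heq
  have hlt : ∀ i, 0 < a i - b i := fun i => sub_pos.2 (lt_of_le_of_ne (hba i) (heq i))
  set c : Fin d → ℝ := fun i => b i / (a i - b i) with hc
  have hc0 : ∀ i, 0 ≤ c i := fun i => (div_pos (hb i) (hlt i)).le
  have hsum : 0 < ∑ i, c i + 1 := by
    linarith [Finset.sum_nonneg fun i (_ : i ∈ Finset.univ) => hc0 i]
  have hmem : ∑ i, c i • bipVec d a b {i}ᶜ ∈ bipPointedCone d a b :=
    sum_mem fun i _ => PointedCone.smul_mem _ (hc0 i) (hcompl i)
  have hval : ∑ i, c i • bipVec d a b {i}ᶜ = (∑ i, c i + 1) • b := by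
    ext j
    have h : ∀ i, c i * bipVec d a b {i}ᶜ j = c i * b j + if j = i then b j else 0 := by
      intro i
      by_cases h : j = i
      · subst h
        have := (hlt j).ne'
        simp only [bipVec, Finset.mem_compl, Finset.mem_singleton, not_true, if_false, if_true, hc]
        field_simp
        ring
      · simp [bipVec, h]
    simp only [Finset.sum_apply, Pi.smul_apply, smul_eq_mul, h, Finset.sum_add_distrib,
      ← Finset.sum_mul]
    simp [add_mul]
  have := PointedCone.smul_mem _ (inv_nonneg.2 hsum.le) (hval ▸ hmem)
  rwa [smul_smul, inv_mul_cancel₀ hsum.ne', one_smul] at this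

theorem bipVec_mem_bipPointedCone (hd : 2 ≤ d) (hb : ∀ i, 0 < b i) (hba : ∀ i, b i ≤ a i)
    (Q : Finset (Fin d)) : bipVec d a b Q ∈ bipPointedCone d a b := by
  rcases Q.eq_empty_or_nonempty with rfl | hQ
  · convert ask_mem_bipPointedCone hd hb hba using 1
    ext; simp [bipVec]
  by_cases hQ' : Q = Finset.univ
  · subst hQ'
    convert bid_mem_bipPointedCone hd hb hba using 1
    ext; simp [bipVec]
  · exact bipVec_mem_of_proper hQ hQ'

theorem mem_bipPointedCone_of_mem_Icc (hd : 2 ≤ d) (hb : ∀ i, 0 < b i) (hba : ∀ i, b i ≤ a i)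
    {y : Fin d → ℝ} (hy : y ∈ Set.Icc b a) : y ∈ bipPointedCone d a b := by
  have hvert : Set.univ.pi (fun i => ({b i, a i} : Set ℝ)) ⊆ bipPointedCone d a b := by
    intro v hv
    suffices v = bipVec d a b {i | v i = b i} from
      this ▸ bipVec_mem_bipPointedCone hd hb hba _
    ext i
    rcases hv i (Set.mem_univ i) with h | h
    · simp [bipVec, h]
    · by_cases h' : v i = b i
      · simp [bipVec, h']
      · simp only [bipVec, Finset.mem_filter, Finset.mem_univ, true_and, h', if_false]
        exact h
  refine convexHull_min hvert (bipPointedCone d a b).convex ?_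
  rw [convexHull_pi]
  intro i _
  beta_reduce
  rw [convexHull_pair, segment_eq_Icc (hba i)]
  exact ⟨hy.1 i, hy.2 i⟩

/-- A nontrivial bid-ask spread makes every round trip through asset `k` costly. -/
theorem mul_bid_lt_mul_ask (hb : ∀ i, 0 < b i) (hba : ∀ i, b i ≤ a i) {k : Fin d}
    (hk : b k < a k) (j : Fin d) : b k * b j < a k * a j :=
  mul_lt_mul hk (hba j) (hb j) ((hb k).trans hk).le

theorem nonneg_of_mem_dualCone (hd : 2 ≤ d) (hb : ∀ i, 0 < b i) (hba : ∀ i, b i ≤ a i)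
    (hstrict : ∃ k, b k < a k) {y : Fin d → ℝ}
    (hy : y ∈ dualCone d (solvencyCone d (bidAsk d a b))) (i : Fin d) : 0 ≤ y i := by
  rw [mem_dualCone_bidAsk_iff hb] at hy
  obtain ⟨k, hk⟩ := hstrict
  have key : ∀ i j, i ≠ j → b i * b j < a i * a j → 0 ≤ y i := by
    intro i j hij h
    have h₁ := mul_le_mul_of_nonneg_left (hy i j hij) ((hb i).trans_le (hba i)).le
    have h₂ := mul_le_mul_of_nonneg_left (hy j i hij.symm) (hb i).le
    by_contra! hneg
    nlinarith [mul_pos_of_neg_of_neg hneg (sub_neg.2 h)]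
  by_cases hik : i = k
  · subst hik
    have : Nontrivial (Fin d) := Fin.nontrivial_iff_two_le.2 hd
    obtain ⟨j, hj⟩ := exists_ne i
    exact key i j hj.symm (mul_bid_lt_mul_ask hb hba hk j)
  · exact key i k hik (by simpa only [mul_comm] using mul_bid_lt_mul_ask hb hba hk i)

theorem dualCone_bidAsk_eq (hd : 2 ≤ d) (hb : ∀ i, 0 < b i) (hba : ∀ i, b i ≤ a i)
    (hstrict : ∃ k, b k < a k) :
    dualCone d (solvencyCone d (bidAsk d a b)) = bipPointedCone d a b := by
  have ha : ∀ i, 0 < a i := fun i => (hb i).trans_le (hba i)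
  apply Set.Subset.antisymm
  · intro y hy
    have h0 := nonneg_of_mem_dualCone hd hb hba hstrict hy
    rw [mem_dualCone_bidAsk_iff hb] at hy
    have : Nonempty (Fin d) := ⟨⟨0, by lia⟩⟩
    obtain ⟨k, hk⟩ := Finite.exists_max fun j => y j / a j
    have hupper : ∀ i, y i ≤ y k / a k * a i := fun i => (div_le_iff₀ (ha i)).1 (hk i)
    have hlower : ∀ i, y k / a k * b i ≤ y i := by
      intro i
      rw [div_mul_eq_mul_div, div_le_iff₀ (ha k)]
      by_cases hik : i = k
      · subst hik
        exact mul_le_mul_of_nonneg_left (hba i) (h0 i)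
      · linarith [hy i k hik]
    rcases (div_nonneg (h0 k) (ha k).le).eq_or_lt with ht | ht
    · have : y = 0 := by
        ext i
        exact le_antisymm (by simpa [← ht] using hupper i) (h0 i)
      rw [this]
      exact zero_mem _
    · have hmem : (y k / a k)⁻¹ • y ∈ bipPointedCone d a b := by
        refine mem_bipPointedCone_of_mem_Icc hd hb hba ⟨fun i => ?_, fun i => ?_⟩
        · exact (le_inv_mul_iff₀ ht).2 (hlower i)
        · exact (inv_mul_le_iff₀ ht).2 (hupper i)
      have := PointedCone.smul_mem _ ht.le hmem
      rwa [smul_smul, mul_inv_cancel₀ ht.ne', one_smul] at this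
  · rintro _ ⟨z, hz, -, rfl⟩
    exact (dualPointedCone d _).sum_mem fun Q _ => PointedCone.smul_mem _ (hz Q)
      (bipVec_mem_dualCone hb hba Q)

theorem sum_mul_bipVec (x : Fin d → ℝ) (Q : Finset (Fin d)) :
    ∑ l, x l * bipVec d a b Q l = ∑ i ∈ Q, b i * x i + ∑ j ∈ Qᶜ, a j * x j := by
  rw [← Finset.sum_add_sum_compl Q]
  congr 1
  · exact Finset.sum_congr rfl fun i hi => by simp [bipVec, hi, mul_comm]
  · exact Finset.sum_congr rfl fun i hi => by simp [bipVec, Finset.mem_compl.1 hi, mul_comm]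

theorem single_mem_solvencyCone_of_ne (hb : ∀ i, 0 < b i) (hba : ∀ i, b i ≤ a i)
    {i j : Fin d} (hij : i ≠ j) (h : b i * b j < a i * a j) :
    (Pi.single i 1 : Fin d → ℝ) ∈ solvencyPointedCone d (bidAsk d a b) := by
  have hi := hb i
  have hj := hb j
  have hs := sub_pos.2 h
  have h₁ := generator_mem_solvencyPointedCone (bidAsk d a b) i j
  have h₂ := generator_mem_solvencyPointedCone (bidAsk d a b) j i
  simp only [bidAsk, hij, hij.symm, if_false] at h₁ h₂
  have ha := hi.trans_le (hba i)
  have h₃ := PointedCone.smul_mem _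
    (show 0 ≤ b i * b j / (a i * a j - b i * b j) by positivity)
    (add_mem (PointedCone.smul_mem _ (show 0 ≤ a i / b j by positivity) h₁) h₂)
  convert h₃ using 1
  ext l
  simp only [Pi.smul_apply, Pi.add_apply, Pi.sub_apply, smul_eq_mul]
  field_simp
  ring

theorem single_mem_solvencyCone (hd : 2 ≤ d) (hb : ∀ i, 0 < b i) (hba : ∀ i, b i ≤ a i)
    (hstrict : ∃ k, b k < a k) (i : Fin d) :
    (Pi.single i 1 : Fin d → ℝ) ∈ solvencyPointedCone d (bidAsk d a b) := by
  obtain ⟨k, hk⟩ := hstrict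
  by_cases hik : i = k
  · subst hik
    have : Nontrivial (Fin d) := Fin.nontrivial_iff_two_le.2 hd
    obtain ⟨j, hj⟩ := exists_ne i
    exact single_mem_solvencyCone_of_ne hb hba hj.symm (mul_bid_lt_mul_ask hb hba hk j)
  · exact single_mem_solvencyCone_of_ne hb hba hik
      (by simpa only [mul_comm] using mul_bid_lt_mul_ask hb hba hk i)

/-- The long positions `x⁺` finance the short positions `x⁻`, each long asset contributing
in proportion to its bid value. -/
theorem mem_solvencyCone_of_bid_ask_value_nonneg (hd : 2 ≤ d) (hb : ∀ i, 0 < b i)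
    (hba : ∀ i, b i ≤ a i) (hstrict : ∃ k, b k < a k) {x : Fin d → ℝ}
    (hx : ∑ j, a j * (x j)⁻ ≤ ∑ i, b i * (x i)⁺) :
    x ∈ solvencyPointedCone d (bidAsk d a b) := by
  have ha : ∀ i, 0 < a i := fun i => (hb i).trans_le (hba i)
  set S := ∑ i, b i * (x i)⁺ with hS
  set T := ∑ j, a j * (x j)⁻ with hT
  have hT0 : 0 ≤ T := Finset.sum_nonneg fun j _ => mul_nonneg (ha j).le (negPart_nonneg _)
  have hS0 : 0 ≤ S := hT0.trans hx
  have hTS : T / S ≤ 1 := div_le_one_of_le₀ hx hS0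
  have hneg : ∀ j, S / S * (x j)⁻ = (x j)⁻ := by
    intro j
    rcases hS0.eq_or_lt with h | h
    · have hT' : T = 0 := le_antisymm (h ▸ hx) hT0
      have := (Finset.sum_eq_zero_iff_of_nonneg
        fun j _ => mul_nonneg (ha j).le (negPart_nonneg (x j))).1 hT' j (Finset.mem_univ j)
      rw [(mul_eq_zero.1 this).resolve_left (ha j).ne', mul_zero]
    · rw [div_self h.ne', one_mul]
  have hexchange : ∀ i j, (b i * (x i)⁺ / S * (x j)⁻) •
      ((a j / b i) • (Pi.single i 1 : Fin d → ℝ) - Pi.single j 1) ∈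
      solvencyPointedCone d (bidAsk d a b) := by
    intro i j
    by_cases hij : i = j
    · subst hij
      rcases le_total (x i) 0 with h | h
      · simp [posPart_eq_zero.2 h]
      · simp [negPart_eq_zero.2 h]
    · have := generator_mem_solvencyPointedCone (bidAsk d a b) i j
      simp only [bidAsk, hij, if_false] at this
      exact PointedCone.smul_mem _ (mul_nonneg (div_nonneg
        (mul_nonneg (hb i).le (posPart_nonneg _)) hS0) (negPart_nonneg _)) this
  have hrest : ∀ i, ((x i)⁺ * (1 - T / S)) • (Pi.single i 1 : Fin d → ℝ) ∈
      solvencyPointedCone d (bidAsk d a b) := fun i =>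
    PointedCone.smul_mem _ (mul_nonneg (posPart_nonneg _) (sub_nonneg.2 hTS))
      (single_mem_solvencyCone hd hb hba hstrict i)
  have hmem := add_mem (sum_mem fun i (_ : i ∈ Finset.univ) => hrest i)
    (sum_mem fun i (_ : i ∈ Finset.univ) => sum_mem fun j (_ : j ∈ Finset.univ) => hexchange i j)
  convert hmem using 1
  ext l
  have h₁ : ∑ j, (x l)⁺ / S * (a j * (x j)⁻) = (x l)⁺ * (T / S) := by
    rw [← Finset.mul_sum]; ring
  have h₂ : ∑ i, b i * (x i)⁺ / S * (x l)⁻ = (x l)⁻ := by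
    rw [← Finset.sum_mul, ← Finset.sum_div, ← hS, hneg]
  have h₃ : ∀ i j, b i * (x i)⁺ / S * (x j)⁻ * (a j / b i) = (x i)⁺ / S * (a j * (x j)⁻) := by
    intro i j
    have := (hb i).ne'
    field_simp
  have h₄ : ∑ i, ∑ j, (x i)⁺ / S * (a j * (x j)⁻) * (Pi.single i 1 : Fin d → ℝ) l =
      (x l)⁺ * (T / S) := by
    rw [Finset.sum_comm]
    simpa [Pi.single_apply] using h₁
  have h₅ : ∑ i, ∑ j, b i * (x i)⁺ / S * (x j)⁻ * (Pi.single j 1 : Fin d → ℝ) l = (x l)⁻ := by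
    simpa [Pi.single_apply] using h₂
  have h₆ : ∑ i, (x i)⁺ * (1 - T / S) * (Pi.single i 1 : Fin d → ℝ) l =
      (x l)⁺ * (1 - T / S) := by
    simp [Pi.single_apply]
  simp only [Pi.add_apply, Finset.sum_apply, Pi.smul_apply, Pi.sub_apply, smul_eq_mul, mul_sub,
    Finset.sum_sub_distrib, ← mul_assoc (_ * (x _)⁻), h₃, h₄, h₅] at h₆ ⊢
  linear_combination -h₆ - (posPart_sub_negPart (x l))

theorem solvencyCone_bidAsk_eq (hd : 2 ≤ d) (hb : ∀ i, 0 < b i) (hba : ∀ i, b i ≤ a i)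
    (hstrict : ∃ k, b k < a k) :
    solvencyCone d (bidAsk d a b) =
      {x : Fin d → ℝ | ∀ Q : Finset (Fin d), Q.Nonempty → Q ≠ Finset.univ →
        0 ≤ ∑ i ∈ Q, b i * x i + ∑ j ∈ Qᶜ, a j * x j} := by
  ext x
  constructor
  · intro hx Q _ _
    rw [← sum_mul_bipVec]
    exact bipVec_mem_dualCone hb hba Q x hx
  · intro hx
    have hdual : ∀ y ∈ bipPointedCone d a b, 0 ≤ x ⬝ᵥ y := by
      rintro _ ⟨z, hz, hz', rfl⟩
      rw [dotProduct_sum]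
      refine Finset.sum_nonneg fun Q _ => ?_
      rw [dotProduct_smul]
      by_cases h : z Q = 0
      · simp [h]
      · refine mul_nonneg (hz Q) ?_
        have := hx Q (hz' Q h).1 (hz' Q h).2
        rwa [← sum_mul_bipVec] at this
    have h := hdual _ (bipVec_mem_bipPointedCone hd hb hba {i | 0 ≤ x i})
    refine mem_solvencyCone_of_bid_ask_value_nonneg hd hb hba hstrict ?_
    rw [← sub_nonneg, ← Finset.sum_sub_distrib]
    refine h.trans_eq (Finset.sum_congr rfl fun i _ => ?_)
    rcases le_or_gt 0 (x i) with hi | hi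
    · simp [bipVec, hi, mul_comm]
    · simp [bipVec, hi.not_ge, posPart_eq_zero.2 hi.le, negPart_eq_neg.2 hi.le, mul_comm]

theorem IsExtremeDir.exists_of_sum_eq {C : PointedCone ℝ (Fin d → ℝ)} {y : Fin d → ℝ}
    (hy : IsExtremeDir d C y) {ι : Type*} (s : Finset ι) (w : ι → Fin d → ℝ)
    (hw : ∀ i ∈ s, w i ∈ C) {β : ℝ} (hβ : 0 < β) (hsum : ∑ i ∈ s, w i = β • y) :
    ∃ i ∈ s, ∃ α : ℝ, 0 < α ∧ w i = α • y := by
  classical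
  induction s using Finset.induction_on generalizing β with
  | empty =>
    rw [Finset.sum_empty] at hsum
    exact absurd hsum.symm (smul_ne_zero hβ.ne' hy.2.1)
  | insert i s hi ih =>
    have hws : ∀ j ∈ s, w j ∈ C := fun j hj => hw j (Finset.mem_insert_of_mem hj)
    have hrec : ∀ {γ : ℝ}, 0 < γ → ∑ j ∈ s, w j = γ • y →
        ∃ j ∈ insert i s, ∃ α : ℝ, 0 < α ∧ w j = α • y := fun hγ h => by
      obtain ⟨j, hj, hα⟩ := ih hws hγ h
      exact ⟨j, Finset.mem_insert_of_mem hj, hα⟩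
    have hwi := hw i (Finset.mem_insert_self i s)
    rw [Finset.sum_insert hi] at hsum
    by_cases h₁ : w i = 0
    · exact hrec hβ (by simpa [h₁] using hsum)
    by_cases h₂ : ∑ j ∈ s, w j = 0
    · exact ⟨i, Finset.mem_insert_self i s, β, hβ, by simpa [h₂] using hsum⟩
    have hβ' := inv_pos.2 hβ
    have hscale : ∀ {v : Fin d → ℝ} {α : ℝ}, β⁻¹ • v = α • y → v = (β * α) • y := by
      intro v α h
      rw [mul_smul, ← h, smul_inv_smul₀ hβ.ne']
    rcases hy.2.2 (β⁻¹ • w i) (β⁻¹ • ∑ j ∈ s, w j)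
        (PointedCone.smul_mem _ hβ'.le hwi)
        (PointedCone.smul_mem _ hβ'.le (sum_mem hws))
        (smul_ne_zero hβ'.ne' h₁) (smul_ne_zero hβ'.ne' h₂)
        (by rw [← smul_add, hsum, inv_smul_smul₀ hβ.ne']) with ⟨α, hα, h⟩ | ⟨α, hα, h⟩
    · exact ⟨i, Finset.mem_insert_self i s, β * α, mul_pos hβ hα, hscale h⟩
    · exact hrec (mul_pos hβ hα) (hscale h)

theorem exists_bipVec_of_isExtremeDir {y : Fin d → ℝ}
    (hy : IsExtremeDir d (bipPointedCone d a b) y) :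
    ∃ Q : Finset (Fin d), Q.Nonempty ∧ Q ≠ Finset.univ ∧
      ∃ α : ℝ, 0 < α ∧ y = α • bipVec d a b Q := by
  obtain ⟨z, hz, hz', hsum⟩ := id hy.1
  have hmem : ∀ Q ∈ Finset.univ, z Q • bipVec d a b Q ∈ bipPointedCone d a b := by
    intro Q _
    by_cases h : z Q = 0
    · simp [h]
    · exact PointedCone.smul_mem _ (hz Q) (bipVec_mem_of_proper (hz' Q h).1 (hz' Q h).2)
  obtain ⟨Q, -, α, hα, h⟩ := hy.exists_of_sum_eq _ _ hmem one_pos (by rw [one_smul, ← hsum])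
  have hzQ : z Q ≠ 0 := fun h0 => by
    rw [h0, zero_smul] at h
    exact smul_ne_zero hα.ne' hy.2.1 h.symm
  refine ⟨Q, (hz' Q hzQ).1, (hz' Q hzQ).2, α⁻¹ * z Q,
    mul_pos (inv_pos.2 hα) ((hz Q).lt_of_ne' hzQ), ?_⟩
  rw [mul_smul, h, inv_smul_smul₀ hα.ne']

theorem card_proper_nonempty (hd : 0 < d) :
    ((Finset.univ.erase (∅ : Finset (Fin d))).erase Finset.univ).card = 2 ^ d - 2 := by
  have : NeZero d := ⟨hd.ne'⟩
  rw [Finset.card_erase_of_mem (by simp [Finset.univ_eq_empty_iff]),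
    Finset.card_erase_of_mem (Finset.mem_univ _), Finset.card_univ, Fintype.card_finset,
    Fintype.card_fin]
  lia

end

/-- Corollary 13: in the bid-ask case `π i j = a j / b i`, the dual cone `K_d^+` is
the cone generated by the vectors `(b on P, a on N)` over all bipartitions `(P,N)`,
the solvency cone is described by the inequalities
`∑_{i∈P} b i * x i + ∑_{j∈N} a j * x j ≥ 0`, and `K_d^+` has at most `2^d - 2`
extreme directions (up to positive scaling). -/
theorem bidAsk_dualCone_and_solvencyCone (d : ℕ) (hd : 2 ≤ d) (a b : Fin d → ℝ)
    (hb : ∀ i, 0 < b i) (hba : ∀ i, b i ≤ a i) (hstrict : ∃ k, b k < a k) :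
    dualCone d (solvencyCone d (bidAsk d a b)) =
      {y : Fin d → ℝ | ∃ z : Finset (Fin d) → ℝ, (∀ Q, 0 ≤ z Q) ∧
        (∀ Q, z Q ≠ 0 → Q.Nonempty ∧ Q ≠ Finset.univ) ∧
        y = ∑ Q : Finset (Fin d), z Q • bipVec d a b Q} ∧
    solvencyCone d (bidAsk d a b) =
      {x : Fin d → ℝ | ∀ Q : Finset (Fin d), Q.Nonempty → Q ≠ Finset.univ →
        0 ≤ ∑ i ∈ Q, b i * x i + ∑ j ∈ Qᶜ, a j * x j} ∧
    ∃ Y : Finset (Fin d → ℝ), Y.card ≤ 2 ^ d - 2 ∧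
      ∀ y : Fin d → ℝ, IsExtremeDir d (dualCone d (solvencyCone d (bidAsk d a b))) y →
        ∃ z ∈ Y, ∃ α : ℝ, 0 < α ∧ y = α • z := by
  rw [dualCone_bidAsk_eq hd hb hba hstrict]
  refine ⟨rfl, solvencyCone_bidAsk_eq hd hb hba hstrict,
    ((Finset.univ.erase ∅).erase Finset.univ).image (bipVec d a b),
    Finset.card_image_le.trans_eq (card_proper_nonempty (by lia)), fun y hy => ?_⟩
  obtain ⟨Q, hQ, hQ', hα⟩ := exists_bipVec_of_isExtremeDir hy
  exact ⟨bipVec d a b Q, Finset.mem_image_of_mem _ (by simp [hQ', hQ.ne_empty]), hα⟩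
end
end

section
/- In the bid-ask special case π_{ij} = a_j/b_i (i ≠ j), π_{ii} = 1, with b_k = a_k for some k ∈ V, the solvency cone can be generated using only transactions through asset k: K_d = cone{ a_j e^i − b_i e^j : (i,j) ∈ (V × {k}) ∪ ({k} × V) }. -/
noncomputable section

/-- A transaction between two distinct assets of a bid-ask market decomposes into two transactions
through an asset `k` without bid-ask spread. -/
theorem bidAsk_generator_eq {d : ℕ} {a b : Fin d → ℝ} (hb : ∀ i, 0 < b i)
    {k : Fin d} (hk : b k = a k) {i j : Fin d} (hij : i ≠ j) :
    bidAsk d a b i j • (Pi.single i 1 : Fin d → ℝ) - (Pi.single j 1 : Fin d → ℝ) =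
      (a j / (b i * b k)) • (a k • (Pi.single i 1 : Fin d → ℝ) -
          b i • (Pi.single k 1 : Fin d → ℝ)) +
        (1 / b k) • (a j • (Pi.single k 1 : Fin d → ℝ) - b k • (Pi.single j 1 : Fin d → ℝ)) := by
  have hi := (hb i).ne'
  have hbk := (hb k).ne'
  ext l
  simp only [bidAsk, if_neg hij, Pi.add_apply, Pi.sub_apply, Pi.smul_apply, smul_eq_mul, ← hk]
  field_simp
  ring

/-- The transaction exchanging asset `i` for asset `k` is a multiple of a generator of
the bid-ask solvency cone. -/
theorem bidAsk_generator_to {d : ℕ} {a b : Fin d → ℝ} (hb : ∀ i, 0 < b i)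
    {k : Fin d} (hk : b k = a k) (i : Fin d) :
    a k • (Pi.single i 1 : Fin d → ℝ) - b i • (Pi.single k 1 : Fin d → ℝ) =
      b i • (bidAsk d a b i k • (Pi.single i 1 : Fin d → ℝ) - (Pi.single k 1 : Fin d → ℝ)) := by
  have hi := (hb i).ne'
  by_cases h : i = k
  · subst h
    simp [bidAsk, hk]
  · rw [bidAsk, if_neg h, smul_sub, smul_smul, mul_div_cancel₀ _ hi]

/-- The transaction exchanging asset `k` for asset `j` is a multiple of a generator of
the bid-ask solvency cone. -/
theorem bidAsk_generator_from {d : ℕ} {a b : Fin d → ℝ} (hb : ∀ i, 0 < b i)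
    {k : Fin d} (hk : b k = a k) (j : Fin d) :
    a j • (Pi.single k 1 : Fin d → ℝ) - b k • (Pi.single j 1 : Fin d → ℝ) =
      b k • (bidAsk d a b k j • (Pi.single k 1 : Fin d → ℝ) - (Pi.single j 1 : Fin d → ℝ)) := by
  have hbk := (hb k).ne'
  by_cases h : k = j
  · subst h
    simp [bidAsk, hk]
  · rw [bidAsk, if_neg h, smul_sub, smul_smul, mul_div_cancel₀ _ hbk]

/-- Proposition 15: in the bid-ask case with `b k = a k` for some `k`, the solvency
cone is the cone generated by the vectors `a j • e^i - b i • e^j` over the pairs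
`(i,j) ∈ (V × {k}) ∪ ({k} × V)`, i.e. all transactions go through asset `k`. -/
theorem bidAsk_solvencyCone_through_k (d : ℕ) (hd : 2 ≤ d) (a b : Fin d → ℝ)
    (hb : ∀ i, 0 < b i) (hba : ∀ i, b i ≤ a i) (hstrict : ∃ l, b l < a l)
    (k : Fin d) (hk : b k = a k) :
    solvencyCone d (bidAsk d a b) =
      {x : Fin d → ℝ | ∃ u w : Fin d → ℝ, (∀ i, 0 ≤ u i) ∧ (∀ j, 0 ≤ w j) ∧
        x = (∑ i : Fin d, u i • (a k • (Pi.single i 1 : Fin d → ℝ) -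
              b i • (Pi.single k 1 : Fin d → ℝ))) +
            (∑ j : Fin d, w j • (a j • (Pi.single k 1 : Fin d → ℝ) -
              b k • (Pi.single j 1 : Fin d → ℝ)))} := by
  have ha : ∀ i, 0 < a i := fun i => (hb i).trans_le (hba i)
  ext x
  constructor
  · rintro ⟨z, hz, rfl⟩
    refine ⟨fun i => ∑ j, if i = j then 0 else z i j * (a j / (b i * b k)),
      fun j => ∑ i, if i = j then 0 else z i j * (1 / b k), fun i => ?_, fun j => ?_, ?_⟩
    · refine Finset.sum_nonneg fun j _ => ?_
      split_ifs
      · exact le_rfl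
      · exact mul_nonneg (hz i j) (div_pos (ha j) (mul_pos (hb i) (hb k))).le
    · refine Finset.sum_nonneg fun i _ => ?_
      split_ifs
      · exact le_rfl
      · exact mul_nonneg (hz i j) (one_div_pos.2 (hb k)).le
    · simp only [Finset.sum_smul]
      rw [Finset.sum_comm (f := fun j i => (if i = j then (0 : ℝ) else z i j * (1 / b k)) • _),
        ← Finset.sum_add_distrib]
      refine Finset.sum_congr rfl fun i _ => ?_
      rw [← Finset.sum_add_distrib]
      refine Finset.sum_congr rfl fun j _ => ?_
      by_cases hij : i = j
      · subst hij
        simp [bidAsk]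
      · rw [bidAsk_generator_eq hb hk hij, if_neg hij, if_neg hij, smul_add, smul_smul, smul_smul]
  · rintro ⟨u, w, hu, hw, rfl⟩
    refine ⟨fun i j => (if j = k then u i * b i else 0) + (if i = k then w j * b k else 0),
      fun i j => add_nonneg ?_ ?_, ?_⟩
    · split_ifs
      · exact mul_nonneg (hu i) (hb i).le
      · exact le_rfl
    · split_ifs
      · exact mul_nonneg (hw j) (hb k).le
      · exact le_rfl
    · simp only [bidAsk_generator_to hb hk, bidAsk_generator_from hb hk, add_smul,
        Finset.sum_add_distrib, ite_smul, zero_smul, Finset.sum_ite_eq', Finset.mem_univ, if_true,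
        smul_smul]
      congr 1
      rw [Finset.sum_comm]
      simp
end
end

section
/- In the bid-ask special case π_{ij} = a_j/b_i (i ≠ j), π_{ii} = 1, with b_k = a_k for some k ∈ V, the dual cone satisfies K_d^+ = cone{ y ∈ ℝ^d : Q ⊆ V \ {k}, y_i = b_i for all i ∈ Q, y_j = a_j for all j ∈ V \ Q }. K_d^+ has at most 2^{d−1} extreme directions (up to positive scaling), and if additionally 0 < b_i < a_i for all i ∈ V \ {k}, then K_d^+ has exactly 2^{d−1} extreme directions. -/
noncomputable section

/-- Every point of a box is the convex combination of the vertices with product weights. -/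
theorem sum_prod_weights_smul_bipVec {d : ℕ} (a b c : Fin d → ℝ) :
    ∑ Q : Finset (Fin d), ((∏ j ∈ Q, c j) * ∏ j ∈ Qᶜ, (1 - c j)) • bipVec d a b Q =
      fun i => c i * b i + (1 - c i) * a i := by
  funext i
  have h := Fintype.prod_add (fun j => c j * if j = i then b j else 1)
    (fun j => (1 - c j) * if j = i then a j else 1)
  have hl : ∏ j, ((c j * if j = i then b j else 1) + (1 - c j) * if j = i then a j else 1) =
      c i * b i + (1 - c i) * a i := by
    rw [Fintype.prod_eq_single i]
    · simp
    · intro j hj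
      simp [hj]
  rw [← hl, h, Finset.sum_apply]
  refine Finset.sum_congr rfl fun Q _ => ?_
  simp only [Finset.prod_mul_distrib, Finset.prod_ite_eq', Pi.smul_apply, smul_eq_mul, bipVec,
    Finset.mem_compl]
  by_cases hi : i ∈ Q <;> simp [hi] <;> ring

/-- When `b k = a k`, the dual cone is the cone over the box `∏ i, [b i, a i]`. -/
theorem mem_dualCone_bidAsk {d : ℕ} {a b : Fin d → ℝ} (hb : ∀ i, 0 < b i)
    (hba : ∀ i, b i ≤ a i) (hstrict : ∃ l, b l < a l) {k : Fin d} (hk : b k = a k)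
    {y : Fin d → ℝ} :
    y ∈ dualCone d (solvencyCone d (bidAsk d a b)) ↔
      ∃ t, 0 ≤ t ∧ ∀ i, t * b i ≤ y i ∧ y i ≤ t * a i := by
  rw [mem_dualCone_solvencyCone]
  have hak : 0 < a k := hk ▸ hb k
  constructor
  · intro h
    have h' : ∀ i j, i ≠ j → y j * b i ≤ a j * y i := by
      intro i j hij
      have := h i j
      rwa [bidAsk, if_neg hij, div_mul_eq_mul_div, le_div_iff₀ (hb i)] at this
    have hyk : y k / a k * a k = y k := div_mul_cancel₀ _ hak.ne'
    have hlow : ∀ i, y k / a k * b i ≤ y i := by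
      intro i
      rcases eq_or_ne i k with rfl | hik
      · rw [hk, hyk]
      · rw [div_mul_eq_mul_div, div_le_iff₀ hak, mul_comm (y i)]
        exact h' i k hik
    have hup : ∀ i, y i ≤ y k / a k * a i := by
      intro i
      rcases eq_or_ne i k with rfl | hik
      · rw [hyk]
      · rw [div_mul_eq_mul_div, le_div_iff₀ hak, mul_comm (y k), ← hk]
        exact h' k i hik.symm
    obtain ⟨l, hl⟩ := hstrict
    refine ⟨y k / a k, ?_, fun i => ⟨hlow i, hup i⟩⟩
    nlinarith [hlow l, hup l]
  · rintro ⟨t, ht, h⟩ i j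
    rw [bidAsk]
    split_ifs with hij
    · simp [hij]
    · rw [div_mul_eq_mul_div, le_div_iff₀ (hb i)]
      have haj : 0 ≤ a j := (hb j).le.trans (hba j)
      calc y j * b i ≤ t * a j * b i := mul_le_mul_of_nonneg_right (h j).2 (hb i).le
        _ = a j * (t * b i) := by ring
        _ ≤ a j * y i := mul_le_mul_of_nonneg_left (h i).1 haj

theorem bipVec_mem_Icc {d : ℕ} {a b : Fin d → ℝ} (hba : ∀ i, b i ≤ a i) (Q : Finset (Fin d))
    (i : Fin d) : b i ≤ bipVec d a b Q i ∧ bipVec d a b Q i ≤ a i := by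
  unfold bipVec
  split_ifs
  · exact ⟨le_rfl, hba i⟩
  · exact ⟨hba i, le_rfl⟩

theorem bipVec_apply_of_eq {d : ℕ} {a b : Fin d → ℝ} {k : Fin d} (hk : b k = a k)
    (Q : Finset (Fin d)) : bipVec d a b Q k = a k := by
  simp [bipVec, hk]

theorem bipVec_injOn {d : ℕ} {a b : Fin d → ℝ} {k : Fin d} (hlt : ∀ i, i ≠ k → b i < a i) :
    Set.InjOn (bipVec d a b) ((Finset.univ.erase k).powerset : Finset (Finset (Fin d))) := by
  intro P hP Q hQ h
  simp only [Finset.coe_powerset, Set.mem_preimage, Set.mem_powerset_iff,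
    Finset.coe_subset] at hP hQ
  ext i
  rcases eq_or_ne i k with rfl | hik
  · exact ⟨fun hi => absurd rfl (Finset.ne_of_mem_erase (hP hi)),
      fun hi => absurd rfl (Finset.ne_of_mem_erase (hQ hi))⟩
  · have hi := congrFun h i
    have := hlt i hik
    simp only [bipVec] at hi
    split_ifs at hi with h1 h2 h2
    · exact iff_of_true h1 h2
    · exact absurd hi this.ne
    · exact absurd hi this.ne'
    · exact iff_of_false h1 h2

theorem card_powerset_univ_erase {d : ℕ} (k : Fin d) :
    (Finset.univ.erase k).powerset.card = 2 ^ (d - 1) := by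
  simp [Finset.card_powerset, Finset.card_erase_of_mem]

theorem dualCone_bidAsk_eq_cone_bipVec {d : ℕ} {a b : Fin d → ℝ} (hb : ∀ i, 0 < b i)
    (hba : ∀ i, b i ≤ a i) (hstrict : ∃ l, b l < a l) {k : Fin d} (hk : b k = a k) :
    dualCone d (solvencyCone d (bidAsk d a b)) =
      {y : Fin d → ℝ | ∃ z : Finset (Fin d) → ℝ, (∀ Q, 0 ≤ z Q) ∧
        (∀ Q, z Q ≠ 0 → k ∉ Q) ∧
        y = ∑ Q : Finset (Fin d), z Q • bipVec d a b Q} := by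
  ext y
  rw [mem_dualCone_bidAsk hb hba hstrict hk, Set.mem_ofPred_eq]
  constructor
  · rintro ⟨t, ht, h⟩
    have hc : ∀ i, ∃ c : ℝ, 0 ≤ c ∧ c ≤ 1 ∧ (b i = a i → c = 0) ∧
        y i = t * (c * b i + (1 - c) * a i) := by
      intro i
      obtain ⟨h1, h2⟩ := h i
      rcases ht.eq_or_lt with rfl | ht
      · exact ⟨0, le_rfl, zero_le_one, fun _ => rfl, by linarith⟩
      rcases (hba i).eq_or_lt with hi | hi
      · refine ⟨0, le_rfl, zero_le_one, fun _ => rfl, ?_⟩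
        rw [hi] at h1
        linarith
      · have hd : 0 < t * (a i - b i) := mul_pos ht (sub_pos.2 hi)
        refine ⟨(t * a i - y i) / (t * (a i - b i)), div_nonneg (by linarith) hd.le,
          (div_le_one hd).2 (by linarith), fun h => absurd h hi.ne, ?_⟩
        have := (sub_pos.2 hi).ne'
        field_simp
        ring
    choose c hc0 hc1 hcz hcy using hc
    refine ⟨fun Q => t * ((∏ j ∈ Q, c j) * ∏ j ∈ Qᶜ, (1 - c j)), fun Q => ?_, fun Q hQ hkQ => ?_, ?_⟩
    · exact mul_nonneg ht (mul_nonneg (Finset.prod_nonneg fun j _ => hc0 j)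
        (Finset.prod_nonneg fun j _ => sub_nonneg.2 (hc1 j)))
    · exact hQ (by simp [Finset.prod_eq_zero hkQ (hcz k hk)])
    · simp only [mul_smul t]
      rw [← Finset.smul_sum, sum_prod_weights_smul_bipVec]
      exact funext hcy
  · rintro ⟨z, hz, -, rfl⟩
    refine ⟨∑ Q, z Q, Finset.sum_nonneg fun Q _ => hz Q, fun i => ?_⟩
    simp only [Finset.sum_apply, Pi.smul_apply, smul_eq_mul, Finset.sum_mul]
    exact ⟨Finset.sum_le_sum fun Q _ => mul_le_mul_of_nonneg_left (bipVec_mem_Icc hba Q i).1 (hz Q),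
      Finset.sum_le_sum fun Q _ => mul_le_mul_of_nonneg_left (bipVec_mem_Icc hba Q i).2 (hz Q)⟩

theorem IsExtremeDir.exists_eq_smul_bipVec {d : ℕ} {a b : Fin d → ℝ} (hb : ∀ i, 0 < b i)
    (hba : ∀ i, b i ≤ a i) (hstrict : ∃ l, b l < a l) {k : Fin d} (hk : b k = a k)
    {y : Fin d → ℝ} (hy : IsExtremeDir d (dualCone d (solvencyCone d (bidAsk d a b))) y) :
    ∃ Q ∈ (Finset.univ.erase k).powerset, ∃ α : ℝ, 0 < α ∧ y = α • bipVec d a b Q := by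
  obtain ⟨hmem, hne, hext⟩ := hy
  obtain ⟨t, ht, h⟩ := (mem_dualCone_bidAsk hb hba hstrict hk).1 hmem
  have htpos : 0 < t := by
    refine ht.lt_of_ne fun h0 => hne (funext fun i => ?_)
    have := h i
    rw [← h0] at this
    simp only [Pi.zero_apply]
    linarith
  have hyk : y k = t * a k := le_antisymm (h k).2 (hk ▸ (h k).1)
  have hykpos : 0 < y k := hyk ▸ mul_pos htpos (hk ▸ hb k)
  have hend : ∀ i, y i = t * b i ∨ y i = t * a i := by
    intro i
    by_contra! hi
    have hlo : t * b i < y i := (h i).1.lt_of_ne hi.1.symm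
    have hhi : y i < t * a i := (h i).2.lt_of_ne hi.2
    have hki : k ≠ i := by
      rintro rfl
      exact hi.2 hyk
    obtain ⟨e, he, he1, he2⟩ : ∃ e : ℝ, 0 < e ∧ 2 * e ≤ y i - t * b i ∧ 2 * e ≤ t * a i - y i :=
      ⟨min (y i - t * b i) (t * a i - y i) / 2,
        half_pos (lt_min (sub_pos.2 hlo) (sub_pos.2 hhi)),
        by linarith [min_le_left (y i - t * b i) (t * a i - y i)],
        by linarith [min_le_right (y i - t * b i) (t * a i - y i)]⟩
    have hpert : ∀ s : ℝ, |s| = e →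
        (1 / 2 : ℝ) • y + Pi.single i s ∈ dualCone d (solvencyCone d (bidAsk d a b)) ∧
        (1 / 2 : ℝ) • y + Pi.single i s ≠ 0 ∧
        ¬ ∃ α : ℝ, 0 < α ∧ (1 / 2 : ℝ) • y + Pi.single i s = α • y := by
      intro s hs
      have hsl := neg_abs_le s
      have hsu := le_abs_self s
      refine ⟨(mem_dualCone_bidAsk hb hba hstrict hk).2 ⟨t / 2, by linarith, fun j => ?_⟩,
        fun h0 => ?_, ?_⟩
      · have hj := h j
        rcases eq_or_ne j i with rfl | hji
        · simp only [Pi.add_apply, Pi.smul_apply, smul_eq_mul, Pi.single_eq_same]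
          constructor <;> linarith
        · simp only [Pi.add_apply, Pi.smul_apply, smul_eq_mul, Pi.single_eq_of_ne hji]
          constructor <;> linarith
      · have := congrFun h0 k
        simp only [Pi.add_apply, Pi.smul_apply, smul_eq_mul, Pi.single_eq_of_ne hki,
          Pi.zero_apply] at this
        linarith
      · rintro ⟨α, -, hα⟩
        have h1 := congrFun hα k
        have h2 := congrFun hα i
        simp only [Pi.add_apply, Pi.smul_apply, smul_eq_mul, Pi.single_eq_of_ne hki,
          Pi.single_eq_same, add_zero] at h1 h2
        have hα2 : 1 / 2 = α := mul_right_cancel₀ hykpos.ne' h1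
        rw [← hα2] at h2
        have hs0 : s = 0 := by linarith
        rw [hs0, abs_zero] at hs
        exact he.ne hs
    obtain ⟨hu, hu0, hun⟩ := hpert e (abs_of_pos he)
    obtain ⟨hv, hv0, hvn⟩ := hpert (-e) (by rw [abs_neg, abs_of_pos he])
    refine (hext _ _ hu hv hu0 hv0 ?_).elim hun hvn
    rw [Pi.single_neg]
    module
  classical
  refine ⟨Finset.univ.filter fun i => y i ≠ t * a i, ?_, t, htpos, funext fun i => ?_⟩
  · rw [Finset.mem_powerset]
    intro i hi
    refine Finset.mem_erase.2 ⟨?_, Finset.mem_univ i⟩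
    rintro rfl
    exact (Finset.mem_filter.1 hi).2 hyk
  · simp only [bipVec, Pi.smul_apply, smul_eq_mul, Finset.mem_filter, Finset.mem_univ, true_and]
    split_ifs with hi
    · exact (hend i).resolve_right hi
    · exact not_not.1 hi

theorem isExtremeDir_bipVec {d : ℕ} {a b : Fin d → ℝ} (hb : ∀ i, 0 < b i)
    (hba : ∀ i, b i ≤ a i) (hstrict : ∃ l, b l < a l) {k : Fin d} (hk : b k = a k) (Q : Finset (Fin d)) :
    IsExtremeDir d (dualCone d (solvencyCone d (bidAsk d a b))) (bipVec d a b Q) := by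
  have hak : 0 < a k := hk ▸ hb k
  refine ⟨(mem_dualCone_bidAsk hb hba hstrict hk).2 ⟨1, zero_le_one, fun i => ?_⟩, fun h0 => ?_, ?_⟩
  · simpa only [one_mul] using bipVec_mem_Icc hba Q i
  · have := congrFun h0 k
    rw [bipVec_apply_of_eq hk] at this
    exact hak.ne' this
  · intro u v hu hv hu0 _ huv
    obtain ⟨s, hs, hu⟩ := (mem_dualCone_bidAsk hb hba hstrict hk).1 hu
    obtain ⟨r, hr, hv⟩ := (mem_dualCone_bidAsk hb hba hstrict hk).1 hv
    have hsr : s + r = 1 := by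
      have := congrFun huv k
      rw [bipVec_apply_of_eq hk, Pi.add_apply, le_antisymm (hu k).2 (hk ▸ (hu k).1),
        le_antisymm (hv k).2 (hk ▸ (hv k).1)] at this
      exact mul_right_cancel₀ hak.ne' (by linarith)
    have hus : u = s • bipVec d a b Q := by
      funext i
      have hi := congrFun huv i
      obtain ⟨hu1, hu2⟩ := hu i
      obtain ⟨hv1, hv2⟩ := hv i
      obtain rfl : r = 1 - s := by linarith
      simp only [bipVec, Pi.add_apply, Pi.smul_apply, smul_eq_mul] at hi ⊢
      split_ifs at hi ⊢ <;> linarith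
    refine Or.inl ⟨s, hs.lt_of_ne ?_, hus⟩
    rintro rfl
    exact hu0 (by rw [hus, zero_smul])

/-- Corollary 16: in the bid-ask case with `b k = a k` for some `k`, the dual cone
`K_d^+` is the cone generated by the vectors `(b on Q, a on V \ Q)` over all
`Q ⊆ V \ {k}`; `K_d^+` has at most `2^(d-1)` extreme directions (up to positive
scaling), and exactly `2^(d-1)` if moreover `b i < a i` for all `i ≠ k`. -/
theorem bidAsk_dualCone_through_k (d : ℕ) (hd : 2 ≤ d) (a b : Fin d → ℝ)
    (hb : ∀ i, 0 < b i) (hba : ∀ i, b i ≤ a i) (hstrict : ∃ l, b l < a l)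
    (k : Fin d) (hk : b k = a k) :
    dualCone d (solvencyCone d (bidAsk d a b)) =
      {y : Fin d → ℝ | ∃ z : Finset (Fin d) → ℝ, (∀ Q, 0 ≤ z Q) ∧
        (∀ Q, z Q ≠ 0 → k ∉ Q) ∧
        y = ∑ Q : Finset (Fin d), z Q • bipVec d a b Q} ∧
    (∃ Y : Finset (Fin d → ℝ), Y.card ≤ 2 ^ (d - 1) ∧
      ∀ y : Fin d → ℝ, IsExtremeDir d (dualCone d (solvencyCone d (bidAsk d a b))) y →
        ∃ z ∈ Y, ∃ α : ℝ, 0 < α ∧ y = α • z) ∧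
    ((∀ i, i ≠ k → b i < a i) →
      ∃ Y : Finset (Fin d → ℝ), Y.card = 2 ^ (d - 1) ∧
        (∀ z ∈ Y, IsExtremeDir d (dualCone d (solvencyCone d (bidAsk d a b))) z) ∧
        (∀ z ∈ Y, ∀ w ∈ Y, (∃ α : ℝ, 0 < α ∧ z = α • w) → z = w) ∧
        (∀ y : Fin d → ℝ, IsExtremeDir d (dualCone d (solvencyCone d (bidAsk d a b))) y →
          ∃ z ∈ Y, ∃ α : ℝ, 0 < α ∧ y = α • z)) := by
  classical
  have hmem : ∀ y : Fin d → ℝ, IsExtremeDir d (dualCone d (solvencyCone d (bidAsk d a b))) y →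
      ∃ z ∈ (Finset.univ.erase k).powerset.image (bipVec d a b), ∃ α : ℝ, 0 < α ∧ y = α • z := by
    intro y hy
    obtain ⟨Q, hQ, h⟩ := hy.exists_eq_smul_bipVec hb hba hstrict hk
    exact ⟨_, Finset.mem_image_of_mem _ hQ, h⟩
  refine ⟨dualCone_bidAsk_eq_cone_bipVec hb hba hstrict hk, ⟨_, ?_, hmem⟩,
    fun hlt => ⟨_, ?_, ?_, ?_, hmem⟩⟩
  · exact Finset.card_image_le.trans (card_powerset_univ_erase k).le
  · rw [Finset.card_image_of_injOn (bipVec_injOn hlt), card_powerset_univ_erase]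
  · intro z hz
    obtain ⟨Q, -, rfl⟩ := Finset.mem_image.1 hz
    exact isExtremeDir_bipVec hb hba hstrict hk Q
  · rintro z hz w hw ⟨α, -, hα⟩
    obtain ⟨P, -, rfl⟩ := Finset.mem_image.1 hz
    obtain ⟨Q, -, rfl⟩ := Finset.mem_image.1 hw
    have h := congrFun hα k
    rw [Pi.smul_apply, bipVec_apply_of_eq hk, bipVec_apply_of_eq hk, smul_eq_mul] at h
    have hak : 0 < a k := hk ▸ hb k
    rw [hα, (mul_eq_right₀ hak.ne').1 h.symm, one_smul]
end
end

section
/- If (a_1,…,a_m) is a G-draconian sequence, then the bipartite graph F with left vertex multiset given by taking each set I_i repeated a_i times (so F has n−1 left vertices and n right vertices, with a left vertex that is a copy of I_i adjacent to the right vertices in I_i) has a spanning tree T in which every left vertex has degree exactly 2. -/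
noncomputable section

/-- `T` is (the edge set of) a spanning tree of the bipartite graph on `L ⊕ R`
with edge set `H ⊆ L × R`: `T ⊆ H` and the corresponding simple graph on `L ⊕ R`
is connected and acyclic. -/
def IsSpanningTreeBip {L R : Type} (H T : Set (L × R)) : Prop :=
  T ⊆ H ∧ (SimpleGraph.fromRel (fun u v : L ⊕ R =>
    ∃ p ∈ T, u = Sum.inl p.1 ∧ v = Sum.inr p.2)).IsTree

/-- Under the strict Hall condition, with one more element than there are sets, one can choose
a child `f w` and a parent `q w` in each set `J w` so that every element other than a root is
a child, and parents have smaller rank than their children. -/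
theorem exists_ranked_child_parent {W V : Type} [Fintype W] [Fintype V] [DecidableEq V]
    (J : W → Finset V) (hcard : Fintype.card W + 1 = Fintype.card V)
    (hJ : ∀ s : Finset W, s.Nonempty → s.card + 1 ≤ (s.biUnion J).card) (r : V) :
    ∃ (f q : W → V) (d : V → ℕ), (∀ w, f w ∈ J w) ∧ (∀ w, q w ∈ J w) ∧
      (∀ w, d (q w) < d (f w)) ∧ ∀ v, v ≠ r → ∃ w, f w = v := by
  classical
  obtain ⟨f, hf, hfJ⟩ := (Finset.all_card_le_biUnion_card_iff_existsInjective'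
    (fun w => (J w).erase r)).1 (by
      intro s
      rcases s.eq_empty_or_nonempty with rfl | hs
      · simp
      · have h := hJ s hs
        have hsub : s.biUnion J ⊆ insert r (s.biUnion fun w => (J w).erase r) := by
          intro v hv
          by_cases hvr : v = r <;> simp_all
        have := (Finset.card_le_card hsub).trans (Finset.card_insert_le _ _)
        omega)
  have hfr : ∀ w, f w ≠ r := fun w => (Finset.mem_erase.1 (hfJ w)).1
  have himage : Finset.univ.image f = Finset.univ.erase r := by
    apply Finset.eq_of_subset_of_card_le
    · intro v hv
      obtain ⟨w, -, rfl⟩ := Finset.mem_image.1 hv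
      simp [hfr]
    · rw [Finset.card_image_of_injective _ hf, Finset.card_erase_of_mem (Finset.mem_univ _),
        Finset.card_univ, Finset.card_univ]
      omega
  have hsurj : ∀ v, v ≠ r → ∃ w, f w = v := by
    intro v hv
    have : v ∈ Finset.univ.image f := by simp [himage, hv]
    simpa using this
  let layer : ℕ → Set V := fun k =>
    Nat.rec (motive := fun _ => Set V) {r}
      (fun _ A => A ∪ {v | ∃ w, f w = v ∧ ∃ u ∈ J w, u ∈ A}) k
  have hsucc : ∀ k, layer (k + 1) = layer k ∪ {v | ∃ w, f w = v ∧ ∃ u ∈ J w, u ∈ layer k} :=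
    fun _ => rfl
  have hreach : ∀ v, ∃ k, v ∈ layer k := by
    by_contra! hne
    obtain ⟨v₀, hv₀⟩ := hne
    let U : Finset V := Finset.univ.filter fun v => ∀ k, v ∉ layer k
    let S : Finset W := Finset.univ.filter fun w => f w ∈ U
    have hrU : ∀ v ∈ U, v ≠ r := by
      rintro v hv rfl
      exact (Finset.mem_filter.1 hv).2 0 rfl
    have hUS : U = S.image f := by
      ext v
      constructor
      · intro hv
        obtain ⟨w, rfl⟩ := hsurj v (hrU v hv)
        exact Finset.mem_image_of_mem _ (by simpa [S] using hv)
      · intro hv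
        obtain ⟨w, hw, rfl⟩ := Finset.mem_image.1 hv
        exact (Finset.mem_filter.1 hw).2
    have hclosed : S.biUnion J ⊆ U := by
      intro u hu
      obtain ⟨w, hw, huw⟩ := Finset.mem_biUnion.1 hu
      refine Finset.mem_filter.2 ⟨Finset.mem_univ _, fun k hk => ?_⟩
      refine (Finset.mem_filter.1 (Finset.mem_filter.1 hw).2).2 (k + 1) ?_
      rw [hsucc]
      exact Or.inr ⟨w, rfl, u, huw, hk⟩
    have hSne : S.Nonempty := by
      have : v₀ ∈ S.image f := hUS ▸ Finset.mem_filter.2 ⟨Finset.mem_univ _, hv₀⟩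
      exact Finset.image_nonempty.1 ⟨v₀, this⟩
    have h₁ := hJ S hSne
    have h₂ := Finset.card_le_card hclosed
    rw [hUS, Finset.card_image_of_injective _ hf] at h₂
    omega
  have hparent : ∀ w, ∃ u ∈ J w, Nat.find (hreach u) < Nat.find (hreach (f w)) := by
    intro w
    have hmem := Nat.find_spec (hreach (f w))
    rcases hk : Nat.find (hreach (f w)) with _ | k
    · rw [hk] at hmem
      exact absurd hmem (hfr w)
    · rw [hk, hsucc] at hmem
      rcases hmem with hmem | ⟨w', hw', u, huJ, hu⟩
      · exact absurd hmem (Nat.find_min (hreach (f w)) (by omega))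
      · rw [hf hw'] at huJ
        exact ⟨u, huJ, (Nat.find_le hu).trans_lt (by omega)⟩
  choose q hqJ hq using hparent
  exact ⟨f, q, fun v => Nat.find (hreach v), fun w => (Finset.mem_erase.1 (hfJ w)).2, hqJ, hq,
    hsurj⟩

/-- The edges of a bipartite graph, counted as pairs, are its edges as a simple graph. -/
theorem card_edgeSet_fromRel_bip {L R : Type} (T : Set (L × R)) :
    Nat.card (SimpleGraph.fromRel (fun u v : L ⊕ R =>
      ∃ p ∈ T, u = Sum.inl p.1 ∧ v = Sum.inr p.2)).edgeSet = T.ncard := by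
  have himage : (SimpleGraph.fromRel (fun u v : L ⊕ R =>
      ∃ p ∈ T, u = Sum.inl p.1 ∧ v = Sum.inr p.2)).edgeSet =
      (fun p : L × R => s(Sum.inl p.1, Sum.inr p.2)) '' T := by
    ext e
    induction e with
    | _ x y => rcases x with x | x <;> rcases y with y | y <;> simp
  have hinj : Function.Injective
      (fun p : L × R => (s(Sum.inl p.1, Sum.inr p.2) : Sym2 (L ⊕ R))) := by
    rintro ⟨x, y⟩ ⟨x', y'⟩ h
    simpa using h
  rw [himage, Nat.card_coe_set_eq, Set.ncard_image_of_injective _ hinj]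

/-- A family satisfying the strict Hall condition, with one more element than there are sets,
has a spanning tree of its incidence graph in which every set has degree two. -/
theorem exists_isSpanningTreeBip_left_degree_two {W V : Type} [Fintype W] [Fintype V]
    [DecidableEq V] (J : W → Finset V) (hcard : Fintype.card W + 1 = Fintype.card V)
    (hJ : ∀ s : Finset W, s.Nonempty → s.card + 1 ≤ (s.biUnion J).card) :
    ∃ T : Set (W × V), IsSpanningTreeBip {p : W × V | p.2 ∈ J p.1} T ∧
      ∀ w, {p ∈ T | p.1 = w}.ncard = 2 := by
  obtain ⟨r⟩ : Nonempty V := Fintype.card_pos_iff.1 (by omega)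
  obtain ⟨f, q, d, hfJ, hqJ, hd, hsurj⟩ := exists_ranked_child_parent J hcard hJ r
  have hne : ∀ w, f w ≠ q w := fun w h => (hd w).ne (by rw [h])
  let T : Set (W × V) := {p | p.2 = f p.1 ∨ p.2 = q p.1}
  refine ⟨T, ⟨?_, ?_⟩, ?_⟩
  · rintro ⟨w, v⟩ (h | h)
    · exact (show v = f w from h) ▸ hfJ w
    · exact (show v = q w from h) ▸ hqJ w
  · rw [SimpleGraph.isTree_iff_connected_and_card]
    constructor
    · set G := SimpleGraph.fromRel (fun u v : W ⊕ V =>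
        ∃ p ∈ T, u = Sum.inl p.1 ∧ v = Sum.inr p.2) with hG
      have hadj : ∀ w v, (w, v) ∈ T → G.Adj (Sum.inl w) (Sum.inr v) := fun w v h =>
        ⟨by simp, Or.inl ⟨(w, v), h, rfl, rfl⟩⟩
      have hright : ∀ k v, d v = k → G.Reachable (Sum.inr v) (Sum.inr r) := by
        intro k
        induction k using Nat.strong_induction_on with
        | _ k ih =>
          rintro v rfl
          by_cases hv : v = r
          · rw [hv]
          · obtain ⟨w, rfl⟩ := hsurj v hv
            exact (hadj w (f w) (Or.inl rfl)).symm.reachable.trans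
              ((hadj w (q w) (Or.inr rfl)).reachable.trans (ih _ (hd w) _ rfl))
      refine SimpleGraph.connected_iff_exists_forall_reachable _ |>.2 ⟨Sum.inr r, ?_⟩
      rintro (w | v)
      · exact ((hadj w (q w) (Or.inr rfl)).reachable.trans (hright _ _ rfl)).symm
      · exact (hright _ _ rfl).symm
    · have hT : T = Set.range (fun w => (w, f w)) ∪ Set.range (fun w => (w, q w)) := by
        ext ⟨w, v⟩
        simp [T, eq_comm]
      have hdisj : Disjoint (Set.range fun w => (w, f w)) (Set.range fun w => (w, q w)) := by
        rw [Set.disjoint_left]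
        rintro _ ⟨w, rfl⟩ ⟨w', h⟩
        obtain ⟨rfl, h⟩ := Prod.mk.inj h
        exact hne _ h.symm
      have hrange : ∀ g : W → V, (Set.range fun w => (w, g w)).ncard = Fintype.card W := by
        intro g
        rw [← Set.image_univ, Set.ncard_image_of_injective _ fun x y h => (Prod.mk.inj h).1,
          Set.ncard_univ, Nat.card_eq_fintype_card]
      rw [card_edgeSet_fromRel_bip, hT, Set.ncard_union_eq hdisj, hrange, hrange,
        Nat.card_eq_fintype_card, Fintype.card_sum]
      omega
  · intro w
    have : {p ∈ T | p.1 = w} = {(w, f w), (w, q w)} := by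
      ext ⟨w', v⟩
      simp only [T, Set.mem_ofPred_eq, Set.mem_insert_iff, Set.mem_singleton_iff, Prod.mk.injEq]
      constructor
      · rintro ⟨h, rfl⟩
        simpa using h
      · rintro (⟨rfl, rfl⟩ | ⟨rfl, rfl⟩) <;> simp
    rw [this, Set.ncard_pair (by simpa using hne w)]

/-- Proposition A.1: if `(a_1,…,a_m)` is a `G`-draconian sequence for the bipartite
graph `G ⊆ K_{m,n}` given by the sets `I i ⊆ [n]` (no isolated vertices), then the
bipartite graph `F` whose left vertices are `a i` copies of each `I i` (a copy of
`I i` being adjacent to the right vertices in `I i`) has a spanning tree in which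
every left vertex has degree exactly `2`. -/
theorem draconian_spanning_tree_left_degree_two (m n : ℕ) (hm : 0 < m) (hn : 0 < n)
    (I : Fin m → Finset (Fin n))
    (hleft : ∀ i, (I i).Nonempty) (hright : ∀ j, ∃ i, j ∈ I i)
    (a : Fin m → ℕ)
    (hsum : ∑ i, a i = n - 1)
    (hdrac : ∀ s : Finset (Fin m), s.Nonempty → ∑ i ∈ s, a i + 1 ≤ (s.biUnion I).card) :
    ∃ T : Set ((Σ i : Fin m, Fin (a i)) × Fin n),
      IsSpanningTreeBip {p : (Σ i : Fin m, Fin (a i)) × Fin n | p.2 ∈ I p.1.1} T ∧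
      ∀ w : Σ i : Fin m, Fin (a i), {p ∈ T | p.1 = w}.ncard = 2 := by
  refine exists_isSpanningTreeBip_left_degree_two
    (fun w : Σ i : Fin m, Fin (a i) => I w.1) ?_ fun s hs => ?_
  · simp only [Fintype.card_sigma, Fintype.card_fin, hsum]
    omega
  · have hcard : s.card ≤ ∑ i ∈ s.image Sigma.fst, a i := by
      have hsub : s ⊆ (s.image Sigma.fst).sigma fun _ => Finset.univ := fun w hw =>
        Finset.mem_sigma.2 ⟨Finset.mem_image_of_mem _ hw, Finset.mem_univ _⟩
      simpa using Finset.card_le_card hsub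
    have h := hdrac (s.image Sigma.fst) (hs.image _)
    rw [Finset.image_biUnion] at h
    omega
end
end
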